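/- arXiv:1207.6983 — 6 statements merged into one kernel-verified Lean document; each statement's English description precedes it below -/
import Mathlib

section
/- Let d < 0 be an integer such that either (d ≡ 1 (mod 4) and d is squarefree) or (d ≡ 0 (mod 4), d/4 is squarefree, and d/4 ≢ 1 (mod 4)). Let f be a positive integer and D = d·f². Let p be a prime, n ≥ 1 an integer, q = p^n, and suppose u, v ∈ ℤ satisfy 4q = u² + |D|·v² and gcd(q, u) = 1. Then p does not divide D, p does not divide f, and: if p is odd then both D and d are nonzero squares modulo p, while if p = 2 then D ≡ 1 (mod 8) and d ≡ 1 (mod 8). -/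
/-- A negative fundamental discriminant: `d < 0` and either `d ≡ 1 (mod 4)` and `d` is
squarefree, or `d ≡ 0 (mod 4)`, `d/4` is squarefree and `d/4 ≢ 1 (mod 4)`. -/
def IsNegFundamentalDiscriminant (d : ℤ) : Prop :=
  d < 0 ∧ ((d % 4 = 1 ∧ Squarefree d) ∨
    (d % 4 = 0 ∧ Squarefree (d / 4) ∧ d / 4 % 4 ≠ 1))

theorem Int.sq_emod_eight_of_odd {a : ℤ} (ha : Odd a) : a ^ 2 % 8 = 1 := by
  have h : a % 8 = 1 ∨ a % 8 = 3 ∨ a % 8 = 5 ∨ a % 8 = 7 := by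
    have := Int.odd_iff.mp ha
    omega
  rcases h with h | h | h | h <;> simp [pow_two, Int.mul_emod, h]

theorem ZMod.isSquare_of_sq_eq_mul_sq {p : ℕ} [Fact p.Prime] {a x y : ZMod p}
    (h : x ^ 2 = a * y ^ 2) (hx : x ≠ 0) : a ≠ 0 ∧ IsSquare a := by
  have hy : y ≠ 0 := by
    rintro rfl
    simp_all
  refine ⟨?_, x / y, ?_⟩
  · rintro rfl
    simp_all
  · field_simp
    exact h.symm

theorem stmt0 (d f D : ℤ) (hd : IsNegFundamentalDiscriminant d) (hf : 0 < f)
    (hD : D = d * f ^ 2) (p : ℕ) (hp : p.Prime) (n : ℕ) (hn : 1 ≤ n)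
    (q u v : ℤ) (hq : q = (p : ℤ) ^ n)
    (huv : 4 * q = u ^ 2 + |D| * v ^ 2) (hgcd : IsCoprime q u) :
    ¬ (p : ℤ) ∣ D ∧ ¬ (p : ℤ) ∣ f ∧
      (Odd p → ((D : ZMod p) ≠ 0 ∧ IsSquare (D : ZMod p)) ∧
        ((d : ZMod p) ≠ 0 ∧ IsSquare (d : ZMod p))) ∧
      (p = 2 → D % 8 = 1 ∧ d % 8 = 1) := by
  have hpZ : Prime (p : ℤ) := Nat.prime_iff_prime_int.mp hp
  have hpq : (p : ℤ) ∣ q := hq ▸ dvd_pow_self _ (by omega)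
  have hpu : ¬ (p : ℤ) ∣ u := fun h => hpZ.not_isUnit (hgcd.isUnit_of_dvd' hpq h)
  have hD0 : D ≤ 0 := hD ▸ mul_nonpos_of_nonpos_of_nonneg hd.1.le (sq_nonneg f)
  have hnorm : u ^ 2 = 4 * q + D * v ^ 2 := by
    rw [abs_of_nonpos hD0] at huv
    linarith
  have hpD : ¬ (p : ℤ) ∣ D := fun h => hpu <| hpZ.dvd_of_dvd_pow (n := 2) <| hnorm ▸
    dvd_add (hpq.mul_left 4) (h.mul_right _)
  have hpf : ¬ (p : ℤ) ∣ f := fun h => hpD <| hD ▸ (dvd_pow h two_ne_zero).mul_left d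
  refine ⟨hpD, hpf, fun _ => ?_, ?_⟩
  · have := Fact.mk hp
    have hq0 : (q : ZMod p) = 0 := (ZMod.intCast_zmod_eq_zero_iff_dvd q p).mpr hpq
    have hu0 : (u : ZMod p) ≠ 0 := fun h => hpu ((ZMod.intCast_zmod_eq_zero_iff_dvd u p).mp h)
    have hmod : (u : ZMod p) ^ 2 = D * (v : ZMod p) ^ 2 := by
      have h := congrArg (Int.cast : ℤ → ZMod p) hnorm
      push_cast at h
      simpa [hq0] using h
    refine ⟨ZMod.isSquare_of_sq_eq_mul_sq hmod hu0,
      ZMod.isSquare_of_sq_eq_mul_sq (y := (f * v : ZMod p)) ?_ hu0⟩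
    rw [hmod, hD]
    push_cast
    ring
  · rintro rfl
    have odd_of {a : ℤ} (h : ¬ ((2 : ℕ) : ℤ) ∣ a) : Odd a :=
      Int.not_even_iff_odd.mp fun ha => h (by exact_mod_cast ha.two_dvd)
    have hpv : ¬ ((2 : ℕ) : ℤ) ∣ v := fun h => hpu <| hpZ.dvd_of_dvd_pow (n := 2) <| hnorm ▸
      dvd_add (hpq.mul_left 4) ((dvd_pow h two_ne_zero).mul_left D)
    have hu8 := Int.sq_emod_eight_of_odd (odd_of hpu)
    have hv8 := Int.sq_emod_eight_of_odd (odd_of hpv)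
    have hf8 := Int.sq_emod_eight_of_odd (odd_of hpf)
    have hDv : D * v ^ 2 % 8 = D % 8 := by simp [Int.mul_emod, hv8]
    have hDd : D % 8 = d % 8 := by simp [hD, Int.mul_emod, hf8]
    push_cast at hpq
    omega
end

section
/- Let d < 0 be a negative fundamental discriminant, f a positive integer, D = d·f². Let p be a prime, n ≥ 1, q = p^n, and suppose u, v ∈ ℤ satisfy 4q = u² + |D|·v² and gcd(q, u) = 1. Let K = ℚ(√d), realized as a subfield of ℂ, with ring of integers 𝓞_K, and let σ denote the nontrivial ℚ-automorphism of K (the restriction of complex conjugation). Then there exists a prime ideal P of 𝓞_K such that p·𝓞_K = P · σ(P) and σ(P) ≠ P, where σ(P) denotes the image ideal of P under σ. -/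
set_option synthInstance.maxHeartbeats 1000000
set_option maxHeartbeats 1000000

/-- The square root of a real number inside `ℂ`: for a negative real `x`,
`√x` denotes `i·√|x|`. -/
noncomputable def csqrt (x : ℝ) : ℂ :=
  if x < 0 then Complex.I * Real.sqrt (-x) else Real.sqrt x

/-- In a commutative ring with an involution whose traces are integers, a prime number `p` dividing
the norm of an element of trace prime to `p` is the product of two distinct conjugate primes. -/
theorem exists_isPrime_span_eq_mul_map {R : Type*} [CommRing R] (σ : R ≃+* R)
    (hinv : ∀ x, σ (σ x) = x) (htr : ∀ x, ∃ s : ℤ, x + σ x = s) {p : ℕ} (hp : p.Prime)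
    (hunit : ¬ IsUnit (p : R)) {u c : ℤ} (hcop : IsCoprime (p : ℤ) u) {ω : R}
    (hadd : ω + σ ω = u) (hmul : ω * σ ω = p * c) :
    ∃ P : Ideal R, P.IsPrime ∧ Ideal.span {(p : R)} = P * Ideal.map σ P ∧ Ideal.map σ P ≠ P := by
  obtain ⟨a, b, hab⟩ := hcop
  have hab' : (a : R) * p + b * u = 1 := by exact_mod_cast congrArg (Int.cast : ℤ → R) hab
  have hmap : Ideal.map σ (Ideal.span {(p : R), ω}) = Ideal.span {(p : R), σ ω} := by
    rw [Ideal.map_span, Set.image_pair, map_natCast]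
  have hprod : Ideal.span {(p : R)} =
      Ideal.span {(p : R), ω} * Ideal.map σ (Ideal.span {(p : R), ω}) := by
    rw [hmap, Ideal.span_pair_mul_span_pair]
    apply le_antisymm
    · rw [Ideal.span_singleton_le_iff_mem]
      have h : (a : R) * (p * p) + (b : R) * (p * σ ω) + (b : R) * (ω * p) = p := by
        linear_combination (p : R) * hab' + b * p * hadd
      refine (congrArg (· ∈ Ideal.span _) h).mp (add_mem (add_mem ?_ ?_) ?_) <;>
        exact Ideal.mul_mem_left _ _ (Ideal.subset_span (by simp))
    · rw [Ideal.span_le]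
      rintro x (rfl | rfl | rfl | rfl) <;> rw [SetLike.mem_coe, Ideal.mem_span_singleton]
      · exact dvd_mul_right _ _
      · exact dvd_mul_right _ _
      · exact dvd_mul_left _ _
      · exact ⟨c, hmul⟩
  have hpP : (p : R) ∈ Ideal.span {(p : R), ω} := Ideal.subset_span (by simp)
  have hωP : ω ∈ Ideal.span {(p : R), ω} := Ideal.subset_span (by simp)
  have hσP : σ ω ∈ Ideal.map σ (Ideal.span {(p : R), ω}) := Ideal.mem_map_of_mem σ hωP
  generalize Ideal.span {(p : R), ω} = P at *
  have htop : P ≠ ⊤ := by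
    rintro rfl
    rw [Ideal.map_top, Ideal.mul_top, Ideal.span_singleton_eq_top] at hprod
    exact hunit hprod
  have hone : (1 : R) ∉ P := fun h => htop ((Ideal.eq_top_iff_one _).2 h)
  have hdvd : ∀ m : ℤ, (m : R) ∈ P → (p : ℤ) ∣ m := by
    intro m hm
    by_contra hnd
    obtain ⟨k, l, hkl⟩ := (Nat.prime_iff_prime_int.1 hp).coprime_iff_not_dvd.2 hnd
    have hkl' : (k : R) * p + l * m = 1 := by exact_mod_cast congrArg (Int.cast : ℤ → R) hkl
    exact hone (hkl' ▸ add_mem (P.mul_mem_left _ hpP) (P.mul_mem_left _ hm))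
  have hres : ∀ x : R, ∃ m : ℤ, x - m ∈ P := by
    intro x
    obtain ⟨s, hs⟩ := htr (x * σ ω)
    rw [map_mul, hinv] at hs
    refine ⟨b * s, ?_⟩
    have h : x - ((b * s : ℤ) : R) = (x * a) * p + (b * (x - σ x)) * ω := by
      push_cast
      linear_combination (-x) * hab' - b * x * hadd + b * hs
    rw [h]
    exact add_mem (P.mul_mem_left _ hpP) (P.mul_mem_left _ hωP)
  have hmem : ∀ (x : R) (m : ℤ), x - m ∈ P → (p : ℤ) ∣ m → x ∈ P := by
    rintro x _ hx ⟨k, rfl⟩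
    have h : x = (x - ((p * k : ℤ) : R)) + k * p := by push_cast; ring
    rw [h]
    exact add_mem hx (P.mul_mem_left _ hpP)
  refine ⟨P, ⟨htop, ?_⟩, hprod, ?_⟩
  · intro x y hxy
    obtain ⟨m, hm⟩ := hres x
    obtain ⟨k, hk⟩ := hres y
    have h : ((m * k : ℤ) : R) = x * y - y * (x - m) - m * (y - k) := by push_cast; ring
    have hmk : ((m * k : ℤ) : R) ∈ P := by
      rw [h]
      exact sub_mem (sub_mem hxy (P.mul_mem_left _ hm)) (P.mul_mem_left _ hk)
    exact ((Nat.prime_iff_prime_int.1 hp).dvd_or_dvd (hdvd _ hmk)).imp (hmem x m hm) (hmem y k hk)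
  · intro heq
    rw [heq] at hσP
    refine hone (hab' ▸ add_mem (P.mul_mem_left _ hpP) (P.mul_mem_left _ ?_))
    rw [← hadd]
    exact add_mem hωP hσP

theorem csqrt_sq (x : ℝ) : csqrt x ^ 2 = x := by
  unfold csqrt
  split_ifs with h
  · rw [mul_pow, Complex.I_sq, ← Complex.ofReal_pow, Real.sq_sqrt (by linarith)]
    push_cast
    ring
  · rw [← Complex.ofReal_pow, Real.sq_sqrt (not_lt.1 h)]

theorem conj_csqrt_of_neg {x : ℝ} (hx : x < 0) : starRingEnd ℂ (csqrt x) = -csqrt x := by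
  simp [csqrt, hx]

theorem exists_eq_add_mul_csqrt {d : ℤ} (hd : d < 0) {x : ℂ}
    (hx : x ∈ IntermediateField.adjoin ℚ {csqrt (d : ℝ)}) :
    ∃ a b : ℚ, x = a + b * csqrt (d : ℝ) := by
  have hsq : csqrt (d : ℝ) ^ 2 = d := by simpa using csqrt_sq (d : ℝ)
  have hconj := conj_csqrt_of_neg (x := (d : ℝ)) (by exact_mod_cast hd)
  induction hx using IntermediateField.adjoin_induction with
  | mem x hx => exact ⟨0, 1, by simpa using hx⟩
  | algebraMap x => exact ⟨x, 0, by simp⟩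
  | add x y _ _ hx hy =>
    obtain ⟨a, b, rfl⟩ := hx
    obtain ⟨a', b', rfl⟩ := hy
    exact ⟨a + a', b + b', by push_cast; ring⟩
  | mul x y _ _ hx hy =>
    obtain ⟨a, b, rfl⟩ := hx
    obtain ⟨a', b', rfl⟩ := hy
    exact ⟨a * a' + d * b * b', a * b' + a' * b, by
      push_cast; linear_combination (b * b' : ℂ) * hsq⟩
  | inv x _ hx =>
    obtain ⟨a, b, rfl⟩ := hx
    by_cases h0 : (a + b * csqrt (d : ℝ) : ℂ) = 0
    · exact ⟨0, 0, by rw [h0]; simp⟩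
    have h1 : (a - b * csqrt (d : ℝ) : ℂ) ≠ 0 := by
      have := (map_ne_zero (starRingEnd ℂ)).2 h0
      simpa [hconj, sub_eq_add_neg] using this
    have hN : (a ^ 2 - d * b ^ 2 : ℂ) = (a + b * csqrt (d : ℝ)) * (a - b * csqrt (d : ℝ)) := by
      linear_combination (b ^ 2 : ℂ) * hsq
    have hN0 : (a ^ 2 - d * b ^ 2 : ℂ) ≠ 0 := hN ▸ mul_ne_zero h0 h1
    refine ⟨a / (a ^ 2 - d * b ^ 2), -b / (a ^ 2 - d * b ^ 2), ?_⟩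
    push_cast
    apply inv_eq_of_mul_eq_one_right
    rw [div_mul_eq_mul_div, ← add_div, mul_div_assoc', div_eq_one_iff_eq hN0, hN]
    ring

theorem exists_int_of_isIntegral_ratCast {A : Type*} [Field A] [CharZero A] {r : ℚ}
    (h : IsIntegral ℤ (r : A)) : ∃ m : ℤ, (m : A) = r := by
  have h' : IsIntegral ℤ r :=
    (isIntegral_algHom_iff (algebraMap ℚ A).toIntAlgHom (algebraMap ℚ A).injective).1
      (by simpa using h)
  obtain ⟨m, hm⟩ := IsIntegrallyClosed.isIntegral_iff.1 h'
  exact ⟨m, by rw [← hm]; simp⟩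

theorem stmt1 (d f D : ℤ) (hd : IsNegFundamentalDiscriminant d) (hf : 0 < f)
    (hD : D = d * f ^ 2) (p n : ℕ) (hp : p.Prime) (hn : 1 ≤ n)
    (q u v : ℤ) (hq : q = (p : ℤ) ^ n)
    (huv : 4 * q = u ^ 2 + |D| * v ^ 2) (hgcd : IsCoprime q u)
    -- `K = ℚ(√d)`, realized as a subfield of `ℂ`
    (K : IntermediateField ℚ ℂ) (hK : K = IntermediateField.adjoin ℚ {csqrt (d : ℝ)})
    -- `σ` is the nontrivial `ℚ`-automorphism of `K`, i.e. the restriction of complex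
    -- conjugation, induced on the ring of integers `𝓞_K = integralClosure ℤ K`
    (σ : integralClosure ℤ K ≃+* integralClosure ℤ K)
    (hσ : ∀ x : integralClosure ℤ K, ((σ x : K) : ℂ) = starRingEnd ℂ ((x : K) : ℂ)) :
    ∃ P : Ideal (integralClosure ℤ K), P.IsPrime ∧
      Ideal.span {(p : integralClosure ℤ K)} = P * Ideal.map σ P ∧
      Ideal.map σ P ≠ P := by
  have hd0 : d < 0 := hd.1
  have hsq : csqrt (d : ℝ) ^ 2 = d := by simpa using csqrt_sq (d : ℝ)
  have hconj := conj_csqrt_of_neg (x := (d : ℝ)) (by exact_mod_cast hd0)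
  have hinj : ∀ x y : integralClosure ℤ K, ((x : K) : ℂ) = ((y : K) : ℂ) → x = y :=
    fun x y h => Subtype.ext (Subtype.ext h)
  have hint : ∀ x : integralClosure ℤ K, IsIntegral ℤ ((x : K) : ℂ) := fun x =>
    (x.2 : IsIntegral ℤ (x : K)).map (algebraMap K ℂ).toIntAlgHom
  have hpq : (p : ℤ) ∣ q := hq ▸ dvd_pow_self _ (by omega)
  obtain ⟨c, hc⟩ := hpq
  have hnorm : (4 * q : ℂ) = u ^ 2 - d * (f * v) ^ 2 := by
    have h : 4 * q = u ^ 2 - d * (f * v) ^ 2 := by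
      rw [huv, hD, abs_of_nonpos (by nlinarith [sq_nonneg f])]
      ring
    exact_mod_cast congrArg (Int.cast : ℤ → ℂ) h
  have hαK : csqrt (d : ℝ) ∈ K := hK ▸ IntermediateField.mem_adjoin_simple_self ℚ _
  have hωK : ((u + f * v * csqrt (d : ℝ)) / 2 : ℂ) ∈ K :=
    div_mem (add_mem (intCast_mem K u)
      (mul_mem (mul_mem (intCast_mem K f) (intCast_mem K v)) hαK)) (ofNat_mem K 2)
  have hωint : IsIntegral ℤ (⟨_, hωK⟩ : K) := by
    refine ⟨Polynomial.X ^ 2 - Polynomial.C u * Polynomial.X + Polynomial.C q, by monicity!, ?_⟩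
    simp only [Polynomial.eval₂_add, Polynomial.eval₂_sub, Polynomial.eval₂_mul,
      Polynomial.eval₂_X_pow, Polynomial.eval₂_X, Polynomial.eval₂_C]
    apply Subtype.ext
    simp
    linear_combination (1 / 4 : ℂ) * hnorm + (f * v : ℂ) ^ 2 / 4 * hsq
  have h2 : starRingEnd ℂ 2 = 2 := map_ofNat _ 2
  refine exists_isPrime_span_eq_mul_map σ (fun x => hinj _ _ (by rw [hσ, hσ, Complex.conj_conj]))
    ?_ hp ?_ (u := u) (c := c) (ω := ⟨⟨_, hωK⟩, hωint⟩)
    (IsCoprime.of_isCoprime_of_dvd_left hgcd ⟨c, hc⟩) ?_ ?_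
  · intro x
    obtain ⟨a, b, hab⟩ := exists_eq_add_mul_csqrt hd0 (x := ((x : K) : ℂ))
      (by rw [← hK]; exact (x : K).2)
    have htr : (((x + σ x : integralClosure ℤ K) : K) : ℂ) = ((2 * a : ℚ) : ℂ) := by
      push_cast
      rw [hσ, hab]
      simp [hconj]
      ring
    obtain ⟨m, hm⟩ := exists_int_of_isIntegral_ratCast (htr ▸ hint (x + σ x))
    exact ⟨m, hinj _ _ (by rw [htr, ← hm]; simp)⟩
  · intro h
    obtain ⟨y, hy⟩ := h.exists_right_inv
    have hy' : (p : ℂ) * ((y : K) : ℂ) = 1 := by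
      simpa using congrArg (fun z : integralClosure ℤ K => ((z : K) : ℂ)) hy
    have hp0 : (p : ℂ) ≠ 0 := by exact_mod_cast hp.ne_zero
    have hyr : ((y : K) : ℂ) = ((1 / p : ℚ) : ℂ) := by
      push_cast
      rw [eq_div_iff hp0, mul_comm, hy']
    obtain ⟨m, hm⟩ := exists_int_of_isIntegral_ratCast (hyr ▸ hint y)
    rw [← hyr] at hm
    rw [← hm] at hy'
    exact (Nat.prime_iff_prime_int.1 hp).not_dvd_one ⟨m, by exact_mod_cast hy'.symm⟩
  · apply hinj
    push_cast
    rw [hσ]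
    simp [hconj, h2]
    ring
  · apply hinj
    push_cast
    rw [hσ]
    have hc' : (q : ℂ) = p * c := by exact_mod_cast congrArg (Int.cast : ℤ → ℂ) hc
    simp [hconj, h2]
    linear_combination hc' - (1 / 4 : ℂ) * hnorm - (f * v : ℂ) ^ 2 / 4 * hsq
end

section
/- Let d < 0 be a negative fundamental discriminant, f a positive integer, D = d·f². Let p be a prime, n ≥ 1, q = p^n, and suppose u, v ∈ ℤ satisfy 4q = u² + |D|·v² and gcd(q, u) = 1. Let K = ℚ(√D) = ℚ(√d) ⊂ ℂ with ring of integers 𝓞_K, and set π = (u + v·√D)/2. Then: (1) there exist a, b ∈ ℤ with π = a + b·(D + √D)/2 (in particular π ∈ 𝓞_K); (2) there exists a prime ideal P of 𝓞_K with P ∩ ℤ = pℤ such that the principal ideal π·𝓞_K equals P^n, and the image P̄ of P under complex conjugation satisfies P̄ ≠ P. -/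
set_option synthInstance.maxHeartbeats 1000000
set_option maxHeartbeats 1000000

section ConjugateIdeals

variable {R : Type*} [CommRing R]

/-- If `x + x' = u` and `x * x' = p ^ n` with `u` coprime to `p`, then `x` generates the `n`-th
power of the ideal `(p, x)`. -/
theorem span_singleton_eq_span_pair_pow {p x x' u : R} {n : ℕ} (hn : 1 ≤ n)
    (hu : x + x' = u) (hq : x * x' = p ^ n) (hpu : IsCoprime p u) :
    Ideal.span {x} = Ideal.span {p, x} ^ n := by
  obtain ⟨a, b, hab⟩ := hpu
  have mem (y z : R) : y ∈ Ideal.span {y, z} ∧ z ∈ Ideal.span {y, z} :=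
    ⟨Ideal.subset_span (by simp), Ideal.subset_span (by simp)⟩
  have hle (y y' : R) (h : y * y' = p ^ n) :
      Ideal.span {p, y} * Ideal.span {p, y'} ≤ Ideal.span {p} := by
    rw [Ideal.span_pair_mul_span_pair, Ideal.span_le]
    rintro z (rfl | rfl | rfl | rfl) <;>
      simp only [SetLike.mem_coe, Ideal.mem_span_singleton]
    · exact dvd_mul_right _ _
    · exact dvd_mul_right _ _
    · exact dvd_mul_left _ _
    · rw [h]
      exact dvd_pow_self p (by omega)
  have hmul : Ideal.span {p, x} * Ideal.span {p, x'} = Ideal.span {p} := by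
    refine le_antisymm (hle x x' hq) ?_
    rw [Ideal.span_singleton_le_iff_mem]
    have h1 := Ideal.mul_mem_mul (mem p x).1 (mem p x').1
    have h2 := Ideal.mul_mem_mul (mem p x).1 (mem p x').2
    have h3 := Ideal.mul_mem_mul (mem p x).2 (mem p x').1
    have h4 := add_mem (Ideal.mul_mem_left _ a h1)
      (Ideal.mul_mem_left _ b (add_mem h2 h3))
    convert h4 using 1
    linear_combination (-p) * hab - p * b * hu
  have hpow : Ideal.span {p, x} ^ n * Ideal.span {p, x'} ^ n =
      Ideal.span {x} * Ideal.span {x'} := by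
    rw [← mul_pow, hmul, Ideal.span_singleton_mul_span_singleton, hq,
      Ideal.span_singleton_pow]
  have hcop1 : IsCoprime (Ideal.span {p, x} ^ n) (Ideal.span {x'}) := by
    refine IsCoprime.pow_left (Ideal.isCoprime_iff_exists.mpr
      ⟨a * p + b * x, add_mem (Ideal.mul_mem_left _ _ (mem p x).1)
        (Ideal.mul_mem_left _ _ (mem p x).2), b * x',
        Ideal.mul_mem_left _ _ (Ideal.mem_span_singleton_self _), ?_⟩)
    linear_combination hab + b * hu
  have hcop2 : IsCoprime (Ideal.span {x}) (Ideal.span {p, x'} ^ n) := by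
    refine IsCoprime.pow_right (Ideal.isCoprime_iff_exists.mpr
      ⟨b * x, Ideal.mul_mem_left _ _ (Ideal.mem_span_singleton_self _), a * p + b * x',
        add_mem (Ideal.mul_mem_left _ _ (mem p x').1)
        (Ideal.mul_mem_left _ _ (mem p x').2), ?_⟩)
    linear_combination hab + b * hu
  apply le_antisymm
  · exact Ideal.le_of_dvd (hcop1.dvd_of_dvd_mul_right ⟨_, hpow.symm⟩)
  · exact Ideal.le_of_dvd (hcop2.dvd_of_dvd_mul_right ⟨_, hpow⟩)

/-- Let `σ` be an involution of `R` all of whose traces `y + σ y` are integers, and let `p` be a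
prime that is not invertible in `R`. If `x + σ x` is prime to `p` and `x * σ x = p ^ n`, then
`(p, x)` is a prime ideal above `p` that is not stable under `σ`. -/
theorem isPrime_span_pair_of_integer_traces (σ : R ≃+* R) (hinv : ∀ y, σ (σ y) = y)
    (htr : ∀ y, ∃ m : ℤ, y + σ y = m) {p : ℤ} (hp : Prime p) (hunit : ¬ IsUnit (p : R))
    {x : R} {u : ℤ} {n : ℕ} (hn : 1 ≤ n) (hu : x + σ x = u) (hq : x * σ x = (p : R) ^ n)
    (hpu : IsCoprime p u) :
    (Ideal.span {(p : R), x}).IsPrime ∧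
      Ideal.comap (algebraMap ℤ R) (Ideal.span {(p : R), x}) = Ideal.span {p} ∧
      Ideal.map σ (Ideal.span {(p : R), x}) ≠ Ideal.span {(p : R), x} := by
  have hpuR : IsCoprime (p : R) (u : R) := by simpa using hpu.map (Int.castRingHom R)
  have hpow := span_singleton_eq_span_pair_pow hn hu hq hpuR
  set P := Ideal.span {(p : R), x} with hP
  have hpP : (p : R) ∈ P := Ideal.subset_span (by simp)
  have hxP : x ∈ P := Ideal.subset_span (by simp)
  have hone : (1 : R) ∉ P := by
    intro h
    rw [(Ideal.eq_top_iff_one P).mpr h, Ideal.top_pow, Ideal.span_singleton_eq_top] at hpow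
    have h2 : IsUnit ((p : R) ^ n) := hq ▸ hpow.mul (hpow.map σ)
    exact hunit ((isUnit_pow_iff (by omega)).mp h2)
  have hint (m : ℤ) : (m : R) ∈ P ↔ p ∣ m := by
    constructor
    · intro h
      by_contra hm
      obtain ⟨a, b, hab⟩ := (Prime.coprime_iff_not_dvd hp).mpr hm
      apply hone
      have h2 := add_mem (Ideal.mul_mem_left P (a : R) hpP) (Ideal.mul_mem_left P (b : R) h)
      have h3 : ((a * p + b * m : ℤ) : R) = 1 := by rw [hab]; simp
      push_cast at h3
      rwa [h3] at h2
    · rintro ⟨k, rfl⟩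
      push_cast
      exact Ideal.mul_mem_right _ _ hpP
  have hu_not : (u : R) ∉ P := by
    intro h
    obtain ⟨a, b, hab⟩ := hpuR
    exact hone (hab ▸ add_mem (Ideal.mul_mem_left P a hpP) (Ideal.mul_mem_left P b h))
  have hres (y : R) : ∃ m : ℤ, y - m ∈ P := by
    obtain ⟨a, b, hab⟩ := hpu
    have habR : (a : R) * p + b * u = 1 := by exact_mod_cast congrArg (Int.cast : ℤ → R) hab
    obtain ⟨m, hm⟩ := htr (b * σ x * y)
    refine ⟨m, ?_⟩
    have h2 := add_mem (Ideal.mul_mem_left P (a * y) hpP)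
      (Ideal.mul_mem_left P (b * y - b * σ y) hxP)
    convert h2 using 1
    rw [← hm]
    simp only [map_mul, map_intCast, hinv]
    linear_combination (-y) * habR - b * y * hu
  refine ⟨⟨fun h => hone (h ▸ Submodule.mem_top), ?_⟩, ?_, ?_⟩
  · intro y z hyz
    obtain ⟨m, hm⟩ := hres y
    obtain ⟨k, hk⟩ := hres z
    have hmk : ((m * k : ℤ) : R) ∈ P := by
      have h2 := sub_mem (sub_mem hyz (Ideal.mul_mem_right z P hm))
        (Ideal.mul_mem_left P (m : R) hk)
      convert h2 using 1
      push_cast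
      ring
    rcases hp.dvd_or_dvd ((hint _).mp hmk) with h | h
    · left
      simpa using add_mem hm ((hint m).mpr h)
    · right
      simpa using add_mem hk ((hint k).mpr h)
  · ext m
    simpa [Ideal.mem_span_singleton] using hint m
  · intro h
    have h2 : σ x ∈ P := h ▸ Ideal.mem_map_of_mem σ hxP
    exact hu_not (hu ▸ add_mem hxP h2)

end ConjugateIdeals

/-- Elements of `ℚ(√D)` with `D < 0` have rational real part, so rational trace to `ℝ`. -/
theorem exists_rat_add_conj_of_mem_adjoin_csqrt {D : ℤ} (hD : D < 0) {z : ℂ}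
    (hz : z ∈ IntermediateField.adjoin ℚ {csqrt (D : ℝ)}) :
    ∃ r : ℚ, z + starRingEnd ℂ z = r := by
  have hDR : (D : ℝ) < 0 := by exact_mod_cast hD
  have hsq : csqrt (D : ℝ) ^ 2 = (D : ℂ) := by simpa using csqrt_sq (D : ℝ)
  have key : ∃ a b : ℚ, z = a + b * csqrt (D : ℝ) := by
    induction hz using IntermediateField.adjoin_induction with
    | mem x hx =>
      rw [Set.mem_singleton_iff] at hx
      exact ⟨0, 1, by simp [hx]⟩
    | algebraMap x => exact ⟨x, 0, by simp⟩
    | add x y _ _ hx hy =>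
      obtain ⟨a, b, rfl⟩ := hx
      obtain ⟨c, e, rfl⟩ := hy
      exact ⟨a + c, b + e, by push_cast; ring⟩
    | mul x y _ _ hx hy =>
      obtain ⟨a, b, rfl⟩ := hx
      obtain ⟨c, e, rfl⟩ := hy
      exact ⟨a * c + b * e * D, a * e + b * c, by
        push_cast; linear_combination (b * e : ℂ) * hsq⟩
    | inv x _ hx =>
      obtain ⟨a, b, rfl⟩ := hx
      by_cases h : a ^ 2 - D * b ^ 2 = 0
      · have hDQ : (D : ℚ) < 0 := by exact_mod_cast hD
        have hb : b = 0 := by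
          by_contra hb
          have : 0 < b ^ 2 := by positivity
          nlinarith [sq_nonneg a]
        have ha : a = 0 := by simpa [hb] using h
        exact ⟨0, 0, by simp [ha, hb]⟩
      · have h' : (a : ℂ) ^ 2 - D * b ^ 2 ≠ 0 := by exact_mod_cast h
        refine ⟨a / (a ^ 2 - D * b ^ 2), -b / (a ^ 2 - D * b ^ 2), ?_⟩
        apply inv_eq_of_mul_eq_one_right
        refine Eq.trans ?_ (div_self h')
        push_cast
        linear_combination (-(b : ℂ) ^ 2 / (a ^ 2 - D * b ^ 2)) * hsq
  obtain ⟨a, b, rfl⟩ := key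
  refine ⟨2 * a, ?_⟩
  simp only [map_add, map_mul, conj_csqrt_of_neg hDR, map_ratCast]
  push_cast
  ring

/-- A rational number that is an algebraic integer in `ℂ` is an integer. -/
theorem exists_int_eq_of_isIntegral_ratCast {r : ℚ} (h : IsIntegral ℤ (r : ℂ)) :
    ∃ m : ℤ, (r : ℂ) = m := by
  have h2 : IsIntegral ℤ (algebraMap ℚ ℂ r) := by simpa using h
  rw [isIntegral_algebraMap_iff (algebraMap ℚ ℂ).injective] at h2
  obtain ⟨m, hm⟩ := IsIntegrallyClosed.isIntegral_iff.mp h2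
  exact ⟨m, by rw [← hm]; simp⟩

theorem stmt2 (d f D : ℤ) (hd : IsNegFundamentalDiscriminant d) (hf : 0 < f)
    (hD : D = d * f ^ 2) (p n : ℕ) (hp : p.Prime) (hn : 1 ≤ n)
    (q u v : ℤ) (hq : q = (p : ℤ) ^ n)
    (huv : 4 * q = u ^ 2 + |D| * v ^ 2) (hgcd : IsCoprime q u)
    -- `K = ℚ(√D) = ℚ(√d)`, realized as a subfield of `ℂ`
    (K : IntermediateField ℚ ℂ) (hK : K = IntermediateField.adjoin ℚ {csqrt (D : ℝ)})
    -- `π = (u + v·√D)/2`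
    (π : ℂ) (hπ : π = ((u : ℂ) + (v : ℂ) * csqrt (D : ℝ)) / 2)
    -- complex conjugation induced on the ring of integers `𝓞_K = integralClosure ℤ K`
    (σ : integralClosure ℤ K ≃+* integralClosure ℤ K)
    (hσ : ∀ x : integralClosure ℤ K, ((σ x : K) : ℂ) = starRingEnd ℂ ((x : K) : ℂ)) :
    (∃ a b : ℤ, π = (a : ℂ) + (b : ℂ) * (((D : ℂ) + csqrt (D : ℝ)) / 2)) ∧
    ∃ P : Ideal (integralClosure ℤ K), P.IsPrime ∧
      Ideal.comap (algebraMap ℤ (integralClosure ℤ K)) P = Ideal.span {(p : ℤ)} ∧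
      (∃ πR : integralClosure ℤ K, ((πR : K) : ℂ) = π ∧ Ideal.span {πR} = P ^ n) ∧
      Ideal.map σ P ≠ P := by
  have hDneg : D < 0 := by
    rw [hD]
    exact mul_neg_of_neg_of_pos hd.1 (by positivity)
  have hDR : (D : ℝ) < 0 := by exact_mod_cast hDneg
  have hsq : csqrt (D : ℝ) ^ 2 = (D : ℂ) := by simpa using csqrt_sq (D : ℝ)
  have hconj := conj_csqrt_of_neg hDR
  rw [abs_of_neg hDneg] at huv
  have hnorm : (4 * q : ℂ) = u ^ 2 - D * v ^ 2 := by
    have := congrArg (Int.cast : ℤ → ℂ) huv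
    push_cast at this
    linear_combination this
  have hcπ : starRingEnd ℂ π = ((u : ℂ) - (v : ℂ) * csqrt (D : ℝ)) / 2 := by
    rw [hπ]
    simp only [map_div₀, map_add, map_mul, map_intCast, map_ofNat, hconj]
    ring
  have hadd : π + starRingEnd ℂ π = u := by
    rw [hcπ, hπ]
    ring
  have hmul : π * starRingEnd ℂ π = q := by
    rw [hcπ, hπ]
    linear_combination (-1 / 4 : ℂ) * hnorm - (v : ℂ) ^ 2 / 4 * hsq
  refine ⟨?_, ?_⟩
  · have heven : Even (u - v * D) := by
      have h1 : Even (u ^ 2 - D * v ^ 2) := ⟨2 * q, by linarith⟩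
      simp only [Int.even_sub, Int.even_mul, Int.even_pow] at h1 ⊢
      tauto
    obtain ⟨a, ha⟩ := heven
    refine ⟨a, v, ?_⟩
    have ha' : (u : ℂ) - v * D = a + a := by exact_mod_cast congrArg (Int.cast : ℤ → ℂ) ha
    rw [hπ]
    linear_combination (1 / 2 : ℂ) * ha'
  have hπK : π ∈ K := by
    have hs : csqrt (D : ℝ) ∈ K := hK ▸ IntermediateField.mem_adjoin_simple_self ℚ _
    rw [hπ]
    exact div_mem (add_mem (intCast_mem K u) (mul_mem (intCast_mem K v) hs))
      (ofNat_mem K 2)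
  have hπint : IsIntegral ℤ (⟨π, hπK⟩ : K) := by
    refine ⟨Polynomial.X ^ 2 - Polynomial.C u * Polynomial.X + Polynomial.C q, ?_, ?_⟩
    · monicity!
    · apply Subtype.ext
      simp only [Polynomial.eval₂_add, Polynomial.eval₂_sub, Polynomial.eval₂_mul,
        Polynomial.eval₂_pow, Polynomial.eval₂_X, Polynomial.eval₂_C]
      simp only [eq_intCast]
      push_cast
      linear_combination π * hadd - hmul
  have hext {x y : integralClosure ℤ K} (h : ((x : K) : ℂ) = ((y : K) : ℂ)) : x = y :=
    Subtype.ext (Subtype.ext h)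
  have hint (x : integralClosure ℤ K) : IsIntegral ℤ ((x : K) : ℂ) :=
    x.2.map (K.val.restrictScalars ℤ)
  have hinv (y : integralClosure ℤ K) : σ (σ y) = y := hext (by simp [hσ])
  have htr (y : integralClosure ℤ K) : ∃ m : ℤ, y + σ y = m := by
    obtain ⟨r, hr⟩ := exists_rat_add_conj_of_mem_adjoin_csqrt hDneg
      ((congrArg (((y : K) : ℂ) ∈ ·) hK).mp (y : K).2)
    have hy := hint (y + σ y)
    push_cast at hy
    rw [hσ, hr] at hy
    obtain ⟨m, hm⟩ := exists_int_eq_of_isIntegral_ratCast hy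
    refine ⟨m, hext ?_⟩
    push_cast
    rw [hσ, hr, hm]
  have hunit : ¬ IsUnit (((p : ℤ) : integralClosure ℤ K)) := by
    intro h
    obtain ⟨y, hy⟩ := h.exists_right_inv
    have hyC : (p : ℂ) * ((y : K) : ℂ) = 1 := by
      have := congrArg (fun z : integralClosure ℤ K => ((z : K) : ℂ)) hy
      simpa using this
    have hyr : ((y : K) : ℂ) = ((1 / p : ℚ) : ℂ) := by
      push_cast
      rw [eq_div_iff (by exact_mod_cast hp.ne_zero), mul_comm]
      exact hyC
    obtain ⟨m, hm⟩ := exists_int_eq_of_isIntegral_ratCast (hyr ▸ hint y)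
    rw [hyr, hm] at hyC
    have h1 : (p : ℤ) * m = 1 := by exact_mod_cast hyC
    exact (Nat.prime_iff_prime_int.mp hp).not_isUnit (IsUnit.of_mul_eq_one _ h1)
  let πR : integralClosure ℤ K := ⟨⟨π, hπK⟩, hπint⟩
  have hu : πR + σ πR = ((u : ℤ) : integralClosure ℤ K) := hext (by
    push_cast
    rw [hσ]
    exact hadd)
  have hn' : πR * σ πR = (((p : ℤ) : integralClosure ℤ K)) ^ n := hext (by
    push_cast
    rw [hσ]
    refine hmul.trans ?_
    rw [hq]
    push_cast
    rfl)
  have hpu : IsCoprime (p : ℤ) u := by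
    rw [hq] at hgcd
    exact (IsCoprime.pow_left_iff (by omega)).mp hgcd
  obtain ⟨h1, h2, h3⟩ := isPrime_span_pair_of_integer_traces σ hinv htr
    (Nat.prime_iff_prime_int.mp hp) hunit hn hu hn' hpu
  exact ⟨_, h1, h2, ⟨πR, rfl, span_singleton_eq_span_pair_pow hn hu hn'
    (by simpa using hpu.map (Int.castRingHom (integralClosure ℤ K)))⟩, h3⟩
end

section
/- Let q̃_1, …, q̃_r be pairwise distinct integers such that each q̃_i ≡ 1 (mod 4) and each |q̃_i| is an odd prime. In ℂ set α_i = (1 + √q̃_i)/2 and ᾱ_i = (1 − √q̃_i)/2. Let M = ℚ(√q̃_1, …, √q̃_r) ⊂ ℂ. Then: (1) the 2^r products α_1^{s_1}⋯α_r^{s_r}, for s ∈ {0,1}^r, form a ℤ-basis of the ring of integers 𝓞_M; (2) the 2^r products ᾱ_1^{s_1}·α_1^{1−s_1}⋯ᾱ_r^{s_r}·α_r^{1−s_r}, for s ∈ {0,1}^r, also form a ℤ-basis of 𝓞_M. -/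
/-- A family `e` of complex numbers is a `ℤ`-basis of the ring of integers
`𝓞_M = integralClosure ℤ M` of a subfield `M ⊂ ℂ`: every `e s` lies in `M` and is
integral over `ℤ`, the family is `ℤ`-linearly independent, and every element of `M`
integral over `ℤ` lies in the `ℤ`-span of the family. -/
def IsIntBasis {ι : Type*} (M : IntermediateField ℚ ℂ) (e : ι → ℂ) : Prop :=
  (∀ s, e s ∈ M) ∧ (∀ s, IsIntegral ℤ (e s)) ∧ LinearIndependent ℤ e ∧
    ∀ x : ℂ, x ∈ M → IsIntegral ℤ x → x ∈ Submodule.span ℤ (Set.range e)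

theorem csqrt_intCast_sq (n : ℤ) : csqrt (n : ℝ) ^ 2 = (n : ℂ) := by
  unfold csqrt
  split_ifs with h
  · rw [mul_pow, Complex.I_sq, ← Complex.ofReal_pow, Real.sq_sqrt (by linarith)]
    push_cast
    ring
  · rw [← Complex.ofReal_pow, Real.sq_sqrt (not_lt.mp h)]
    simp

theorem exists_int_of_isIntegral_of_mem_bot {x : ℂ}
    (hx : x ∈ (⊥ : IntermediateField ℚ ℂ)) (hint : IsIntegral ℤ x) : ∃ n : ℤ, x = n := by
  obtain ⟨y, rfl⟩ := IntermediateField.mem_bot.mp hx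
  rw [isIntegral_algebraMap_iff (algebraMap ℚ ℂ).injective] at hint
  obtain ⟨n, rfl⟩ := IsIntegrallyClosed.isIntegral_iff.mp hint
  exact ⟨n, by simp⟩

theorem dvd_of_isIntegral_div {m n : ℤ} (hn : n ≠ 0) (h : IsIntegral ℤ ((m : ℂ) / n)) :
    n ∣ m := by
  have hmem : (m : ℂ) / n ∈ (⊥ : IntermediateField ℚ ℂ) :=
    div_mem (intCast_mem _ m) (intCast_mem _ n)
  obtain ⟨k, hk⟩ := exists_int_of_isIntegral_of_mem_bot hmem h
  have hn' : (n : ℂ) ≠ 0 := by exact_mod_cast hn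
  rw [div_eq_iff hn'] at hk
  exact ⟨k, by rw [mul_comm]; exact_mod_cast hk⟩

theorem IsIntegral.of_eq {x y : ℂ} (hx : IsIntegral ℤ x) (h : x = y) : IsIntegral ℤ y :=
  h ▸ hx

theorem IsIntegral.div_of_isCoprime {m p : ℤ} (hp : p ≠ 0) (hmp : IsCoprime m p) {x : ℂ}
    (hx : IsIntegral ℤ x) (hmx : IsIntegral ℤ (m * x / p)) : IsIntegral ℤ (x / p) := by
  obtain ⟨u, v, huv⟩ := hmp
  have hp' : (p : ℂ) ≠ 0 := by exact_mod_cast hp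
  have huv' : (u : ℂ) * m + v * p = 1 := by exact_mod_cast huv
  have : x / p = u * (m * x / p) + v * x := by
    field_simp
    linear_combination -x * huv'
  rw [this]
  exact ((isIntegral_intCast u).mul hmx).add ((isIntegral_intCast v).mul hx)

/-- The ring of integers of `K` is reduced modulo `p`. -/
def ReducedMod (K : IntermediateField ℚ ℂ) (p : ℤ) : Prop :=
  ∀ x ∈ K, IsIntegral ℤ x → IsIntegral ℤ (x ^ 2 / p) → IsIntegral ℤ (x / p)

theorem reducedMod_bot {p : ℤ} (hp : Prime p) : ReducedMod ⊥ p := by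
  intro x hx hint h
  obtain ⟨n, rfl⟩ := exists_int_of_isIntegral_of_mem_bot hx hint
  have hdvd : p ∣ n ^ 2 := dvd_of_isIntegral_div hp.ne_zero (by exact_mod_cast h)
  obtain ⟨k, rfl⟩ := hp.dvd_of_dvd_pow hdvd
  have hp' : (p : ℂ) ≠ 0 := by exact_mod_cast hp.ne_zero
  have : ((p * k : ℤ) : ℂ) / p = k := by
    push_cast
    field_simp
  rw [this]
  exact isIntegral_intCast k

theorem isIntegral_of_sq_eq_intCast {q : ℤ} {s : ℂ} (hs : s ^ 2 = q) : IsIntegral ℤ s :=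
  IsIntegral.of_pow two_pos (hs ▸ isIntegral_intCast q)

theorem ReducedMod.sqrt_notMem {K : IntermediateField ℚ ℂ} {q : ℤ} (hK : ReducedMod K q)
    (hq : Prime q) {s : ℂ} (hs : s ^ 2 = q) : s ∉ K := by
  intro hmem
  have hq' : (q : ℂ) ≠ 0 := by exact_mod_cast hq.ne_zero
  have h : IsIntegral ℤ (s / q) := by
    refine hK s hmem (isIntegral_of_sq_eq_intCast hs) ?_
    rw [hs, div_self hq']
    exact isIntegral_one
  have h2 : IsIntegral ℤ (((1 : ℤ) : ℂ) / q) := by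
    have : ((1 : ℤ) : ℂ) / q = (s / q) ^ 2 := by
      rw [div_pow, hs]
      push_cast
      field_simp
    rw [this]
    exact h.pow 2
  exact hq.not_isUnit (isUnit_of_dvd_one (dvd_of_isIntegral_div hq.ne_zero h2))

theorem exists_add_mul_of_mem_adjoin {K : IntermediateField ℚ ℂ} {q : ℤ} {s : ℂ}
    (hs : s ^ 2 = q) {z : ℂ} (hz : z ∈ IntermediateField.adjoin K {s}) :
    ∃ x ∈ K, ∃ y ∈ K, z = x + y * s := by
  have hint : IsIntegral K s := (isIntegral_of_sq_eq_intCast hs).tower_top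
  rw [← IntermediateField.mem_toSubalgebra,
    IntermediateField.adjoin_simple_toSubalgebra_of_isAlgebraic hint.isAlgebraic] at hz
  induction hz using Algebra.adjoin_induction with
  | mem z hz =>
    rw [Set.mem_singleton_iff] at hz
    exact ⟨0, zero_mem _, 1, one_mem _, by simp [hz]⟩
  | algebraMap c => exact ⟨c, c.2, 0, zero_mem _, by simp⟩
  | add z w _ _ hz hw =>
    obtain ⟨x, hx, y, hy, rfl⟩ := hz
    obtain ⟨x', hx', y', hy', rfl⟩ := hw
    exact ⟨x + x', add_mem hx hx', y + y', add_mem hy hy', by ring⟩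
  | mul z w _ _ hz hw =>
    obtain ⟨x, hx, y, hy, rfl⟩ := hz
    obtain ⟨x', hx', y', hy', rfl⟩ := hw
    refine ⟨x * x' + y * y' * q, add_mem (mul_mem hx hx') (mul_mem (mul_mem hy hy')
      (intCast_mem K q)), x * y' + y * x', add_mem (mul_mem hx hy') (mul_mem hy hx'), ?_⟩
    linear_combination y * y' * hs

theorem IsIntegral.sub_mul_sqrt {K : IntermediateField ℚ ℂ} {q : ℤ} {s : ℂ}
    (hs : s ^ 2 = q) (hsK : s ∉ K) {x y : ℂ} (hx : x ∈ K) (hy : y ∈ K)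
    (h : IsIntegral ℤ (x + y * s)) : IsIntegral ℤ (x - y * s) := by
  have hint : IsIntegral K s := (isIntegral_of_sq_eq_intCast hs).tower_top
  have hdvd : minpoly K s ∣ Polynomial.X ^ 2 - Polynomial.C (q : K) :=
    minpoly.dvd K s (by simp [hs])
  have hmin : minpoly K s = Polynomial.X ^ 2 - Polynomial.C (q : K) := by
    refine (Polynomial.eq_of_monic_of_dvd_of_natDegree_le (minpoly.monic hint)
      (Polynomial.monic_X_pow_sub_C _ two_ne_zero) hdvd ?_).symm
    rw [Polynomial.natDegree_X_pow_sub_C, minpoly.two_le_natDegree_iff hint]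
    rintro ⟨t, rfl⟩
    exact hsK t.2
  have haeval : Polynomial.aeval (-s)
      (minpoly K (IntermediateField.adjoin.powerBasis hint).gen) = 0 := by
    rw [IntermediateField.adjoin.powerBasis_gen, IntermediateField.minpoly_gen, hmin]
    simp [hs]
  let f : IntermediateField.adjoin K {s} →ₐ[K] ℂ :=
    (IntermediateField.adjoin.powerBasis hint).lift (-s) haeval
  have hf : f (IntermediateField.AdjoinSimple.gen K s) = -s := by
    have := (IntermediateField.adjoin.powerBasis hint).lift_gen (-s) haeval
    rwa [IntermediateField.adjoin.powerBasis_gen] at this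
  let z : IntermediateField.adjoin K {s} :=
    algebraMap K _ ⟨x, hx⟩ + algebraMap K _ ⟨y, hy⟩ * IntermediateField.AdjoinSimple.gen K s
  have hz : IsIntegral ℤ z :=
    (isIntegral_algebraMap_iff (R := ℤ)
      (algebraMap (IntermediateField.adjoin K {s}) ℂ).injective).mp h
  have hfz : f z = x - y * s := by
    simp only [z, map_add, map_mul, hf, AlgHom.commutes, IntermediateField.algebraMap_apply]
    ring
  rw [← hfz]
  exact hz.map (f.restrictScalars ℤ)

theorem ReducedMod.adjoin_sqrt {K : IntermediateField ℚ ℂ} {p q : ℤ} (hp : Prime p)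
    (hpq : IsCoprime (2 * q) p) {s : ℂ} (hs : s ^ 2 = q) (hsK : s ∉ K)
    (hK : ReducedMod K p) {K' : IntermediateField ℚ ℂ}
    (hK' : ∀ z ∈ K', ∃ x ∈ K, ∃ y ∈ K, z = x + y * s) : ReducedMod K' p := by
  intro z hz hint hsq
  obtain ⟨x, hx, y, hy, rfl⟩ := hK' z hz
  have hp' : (p : ℂ) ≠ 0 := by exact_mod_cast hp.ne_zero
  have hint' := hint.sub_mul_sqrt hs hsK hx hy
  have hqK : (q : ℂ) ∈ K := intCast_mem K q
  have h2K : (2 : ℂ) ∈ K := ofNat_mem K 2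
  have hqi : IsIntegral ℤ (q : ℂ) := isIntegral_intCast q
  have hpK : (p : ℂ) ∈ K := intCast_mem K p
  have h2i : IsIntegral ℤ (2 : ℂ) := by exact_mod_cast isIntegral_intCast 2
  have hsi := isIntegral_of_sq_eq_intCast hs
  have hsq' : IsIntegral ℤ ((x - y * s) ^ 2 / p) := by
    have : IsIntegral ℤ ((x ^ 2 + y ^ 2 * q) / p - 2 * x * y / p * s) := by
      refine IsIntegral.sub_mul_sqrt hs hsK
        (div_mem (add_mem (pow_mem hx 2) (mul_mem (pow_mem hy 2) hqK)) hpK)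
        (div_mem (mul_mem (mul_mem h2K hx) hy) hpK) ?_
      refine IsIntegral.of_eq hsq ?_
      field_simp
      linear_combination y ^ 2 * hs
    refine IsIntegral.of_eq this ?_
    field_simp
    linear_combination -y ^ 2 * hs
  have hnorm : IsIntegral ℤ ((x + y * s) * (x - y * s) / p) := by
    refine IsIntegral.of_pow two_pos ?_
    refine IsIntegral.of_eq (hsq.mul hsq') ?_
    ring
  have htrace : IsIntegral ℤ (2 * x / p) := by
    refine hK _ (mul_mem h2K hx) ?_ ?_
    · refine IsIntegral.of_eq (hint.add hint') ?_
      ring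
    · refine IsIntegral.of_eq ((hsq.add hsq').add (h2i.mul hnorm)) ?_
      ring
  have hdiff : IsIntegral ℤ (2 * y * q / p) := by
    refine hK _ (mul_mem (mul_mem h2K hy) hqK) ?_ ?_
    · refine IsIntegral.of_eq ((hint.sub hint').mul hsi) ?_
      linear_combination 2 * y * hs
    · refine IsIntegral.of_eq (hqi.mul ((hsq.add hsq').sub (h2i.mul hnorm))) ?_
      field_simp
      linear_combination 4 * y ^ 2 * q * hs
  refine hint.div_of_isCoprime hp.ne_zero hpq ?_
  refine IsIntegral.of_eq ((hqi.mul htrace).add (hdiff.mul hsi)) ?_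
  push_cast
  ring

theorem isIntegral_half_one_add_sqrt {q : ℤ} (hq : q % 4 = 1) {s : ℂ} (hs : s ^ 2 = q) :
    IsIntegral ℤ ((1 + s) / 2) := by
  obtain ⟨k, rfl⟩ : ∃ k, q = 4 * k + 1 := ⟨q / 4, by omega⟩
  refine ⟨Polynomial.X ^ 2 - Polynomial.X - Polynomial.C k, by monicity!, ?_⟩
  rw [Polynomial.eval₂_sub, Polynomial.eval₂_sub, Polynomial.eval₂_pow, Polynomial.eval₂_X,
    Polynomial.eval₂_C, eq_intCast]
  push_cast at hs
  linear_combination hs / 4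

theorem ReducedMod.exists_isIntegral_add_mul {K : IntermediateField ℚ ℂ} {q : ℤ}
    (hK : ReducedMod K q) (hq : Prime q) (hq1 : q % 4 = 1) {s : ℂ} (hs : s ^ 2 = q)
    {x y : ℂ} (hx : x ∈ K) (hy : y ∈ K) (hint : IsIntegral ℤ (x + y * s)) :
    ∃ u ∈ K, ∃ v ∈ K, IsIntegral ℤ u ∧ IsIntegral ℤ v ∧ x + y * s = u + v * ((1 + s) / 2) := by
  have hq' : (q : ℂ) ≠ 0 := by exact_mod_cast hq.ne_zero
  have hint' := hint.sub_mul_sqrt hs (hK.sqrt_notMem hq hs) hx hy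
  have hyK : 2 * y ∈ K := mul_mem (ofNat_mem K 2) hy
  have hdiff : IsIntegral ℤ (2 * y * s) := by
    refine IsIntegral.of_eq (hint.sub hint') ?_
    ring
  have hyint : IsIntegral ℤ (2 * y) := by
    have := hK (2 * y * q) (mul_mem hyK (intCast_mem K q)) (by
        refine IsIntegral.of_eq (hdiff.mul (isIntegral_of_sq_eq_intCast hs)) ?_
        linear_combination 2 * y * hs) (by
        refine IsIntegral.of_eq (hdiff.pow 2) ?_
        field_simp
        linear_combination y ^ 2 * hs)
    rwa [mul_div_cancel_right₀ _ hq'] at this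
  refine ⟨x - y, sub_mem hx hy, 2 * y, hyK, ?_, hyint, by ring⟩
  refine IsIntegral.of_eq (hint.sub (hyint.mul (isIntegral_half_one_add_sqrt hq1 hs))) ?_
  ring

theorem IsIntBasis.cons {K K' : IntermediateField ℚ ℂ} (hle : K ≤ K') {n : ℕ}
    {e : (Fin n → Fin 2) → ℂ} (he : IsIntBasis K e) {w : Fin 2 → ℂ}
    (hw : ∀ b, w b ∈ K') (hwint : ∀ b, IsIntegral ℤ (w b))
    (hindep : ∀ x ∈ K, ∀ y ∈ K, x * w 0 + y * w 1 = 0 → x = 0 ∧ y = 0)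
    (hspan : ∀ z ∈ K', IsIntegral ℤ z →
      ∃ x ∈ K, ∃ y ∈ K, IsIntegral ℤ x ∧ IsIntegral ℤ y ∧ z = x * w 0 + y * w 1) :
    IsIntBasis K' fun t : Fin (n + 1) → Fin 2 => w (t 0) * e (Fin.tail t) := by
  obtain ⟨hmem, hint, hli, hsp⟩ := he
  refine ⟨fun t => mul_mem (hw _) (hle (hmem _)), fun t => (hwint _).mul (hint _), ?_, ?_⟩
  · rw [Fintype.linearIndependent_iff] at hli ⊢
    intro g hg
    have hsum : ∑ p : Fin 2 × (Fin n → Fin 2), g (Fin.cons p.1 p.2) • (w p.1 * e p.2) = 0 := by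
      rw [← hg]
      exact Fintype.sum_equiv (Fin.consEquiv fun _ => Fin 2) _ _ fun p => by
        simp [Fin.consEquiv]
    have hK (b : Fin 2) : ∑ t, g (Fin.cons b t) • e t ∈ K :=
      sum_mem fun t _ => zsmul_mem (hmem t) _
    have hzero := hindep _ (hK 0) _ (hK 1) (by
      rw [← hsum, Fintype.sum_prod_type, Fin.sum_univ_two, Finset.sum_mul, Finset.sum_mul]
      simp only [smul_mul_assoc, mul_comm (w _)])
    intro t
    rw [← Fin.cons_self_tail t]
    generalize t 0 = b
    fin_cases b
    · exact hli _ hzero.1 _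
    · exact hli _ hzero.2 _
  · intro z hz hzint
    obtain ⟨x, hx, y, hy, hxi, hyi, rfl⟩ := hspan z hz hzint
    have key (b : Fin 2) {c : ℂ} (hc : c ∈ Submodule.span ℤ (Set.range e)) :
        c * w b ∈ Submodule.span ℤ (Set.range fun t : Fin (n + 1) → Fin 2 =>
          w (t 0) * e (Fin.tail t)) := by
      induction hc using Submodule.span_induction with
      | mem c hc =>
        obtain ⟨t, rfl⟩ := hc
        exact Submodule.subset_span ⟨Fin.cons b t, by simp [mul_comm]⟩
      | zero => simp
      | add c d _ _ hc hd => rw [add_mul]; exact add_mem hc hd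
      | smul m c _ hc => rw [smul_mul_assoc]; exact Submodule.smul_mem _ m hc
    exact add_mem (key 0 (hsp x hx hxi)) (key 1 (hsp y hy hyi))

theorem isIntBasis_adjoin_sqrt_and_reducedMod (r : ℕ) (q : Fin r → ℤ) (s : Fin r → ℂ)
    (hs : ∀ i, s i ^ 2 = q i) (hmod : ∀ i, q i % 4 = 1) (hprime : ∀ i, Prime (q i))
    (hcop : Pairwise fun i j => IsCoprime (q i) (q j)) (w : Fin r → Fin 2 → ℂ)
    (hw : ∀ i, (w i 0 = 1 ∧ w i 1 = (1 + s i) / 2) ∨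
      (w i 0 = (1 + s i) / 2 ∧ w i 1 = (1 - s i) / 2)) :
    IsIntBasis (IntermediateField.adjoin ℚ (Set.range s))
        (fun t : Fin r → Fin 2 => ∏ i, w i (t i)) ∧
      ∀ p : ℤ, Prime p → IsCoprime 2 p → (∀ i, IsCoprime (q i) p) →
        ReducedMod (IntermediateField.adjoin ℚ (Set.range s)) p := by
  induction r with
  | zero =>
    rw [Set.range_eq_empty, IntermediateField.adjoin_empty]
    refine ⟨⟨fun t => by simp, fun t => by simpa using isIntegral_one, ?_, ?_⟩,
      fun p hp _ _ => reducedMod_bot hp⟩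
    · rw [Fintype.linearIndependent_iff]
      intro g hg t
      rw [Fintype.sum_subsingleton _ t] at hg
      exact (smul_eq_zero.mp hg).resolve_right (by simp)
    · intro x hx hint
      obtain ⟨n, rfl⟩ := exists_int_of_isIntegral_of_mem_bot hx hint
      have h1 : (1 : ℂ) ∈ Submodule.span ℤ
          (Set.range fun t : Fin 0 → Fin 2 => ∏ i, w i (t i)) :=
        Submodule.subset_span ⟨default, by simp⟩
      simpa using Submodule.smul_mem _ n h1
  | succ r ih =>
    obtain ⟨hbasis, hred⟩ := ih (q ∘ Fin.succ) (s ∘ Fin.succ) (fun i => hs _) (fun i => hmod _)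
      (fun i => hprime _) (fun i j hij => hcop ((Fin.succ_injective r).ne hij))
      (w ∘ Fin.succ) (fun i => hw _)
    set K := IntermediateField.adjoin ℚ (Set.range (s ∘ Fin.succ))
    set K' := IntermediateField.adjoin ℚ (Set.range s) with hK'def
    have hle : K ≤ K' := IntermediateField.adjoin.mono _ _ _ (Set.range_comp_subset_range _ _)
    have hs0 : s 0 ∈ K' := IntermediateField.subset_adjoin _ _ ⟨0, rfl⟩
    have hrange : Set.range s = Set.range (s ∘ Fin.succ) ∪ {s 0} := by
      rw [← Fin.cons_self_tail s, Fin.range_cons, Set.union_comm]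
      rfl
    have hexists : ∀ z ∈ K', ∃ x ∈ K, ∃ y ∈ K, z = x + y * s 0 := by
      intro z hz
      rw [hK'def, hrange, ← IntermediateField.adjoin_adjoin_left] at hz
      exact exists_add_mul_of_mem_adjoin (hs 0) hz
    have hcop2 (i : Fin (r + 1)) : IsCoprime 2 (q i) := by
      have := hmod i
      exact ⟨-(q i / 2), 1, by omega⟩
    have hredq : ReducedMod K (q 0) := hred _ (hprime 0) (hcop2 0)
      (fun i => hcop (Fin.succ_ne_zero i))
    have hnot := hredq.sqrt_notMem (hprime 0) (hs 0)
    refine ⟨?_, fun p hp h2 hqp => (hred p hp h2 fun i => hqp _).adjoin_sqrt hp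
      (h2.mul_left (hqp 0)) (hs 0) hnot hexists⟩
    have hfun : (fun t : Fin (r + 1) → Fin 2 => ∏ i, w i (t i)) = fun t =>
        w 0 (t 0) * (fun t' : Fin r → Fin 2 => ∏ i, (w ∘ Fin.succ) i (t' i)) (Fin.tail t) := by
      ext t
      rw [Fin.prod_univ_succ]
      rfl
    have h2 : (2 : ℂ) ∈ K' := ofNat_mem K' 2
    have hα : (1 + s 0) / 2 ∈ K' := div_mem (add_mem (one_mem _) hs0) h2
    have hβ : (1 - s 0) / 2 ∈ K' := div_mem (sub_mem (one_mem _) hs0) h2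
    have hαi := isIntegral_half_one_add_sqrt (hmod 0) (hs 0)
    have hβi : IsIntegral ℤ ((1 - s 0) / 2) := by
      rw [sub_eq_add_neg]
      exact isIntegral_half_one_add_sqrt (hmod 0) ((neg_sq _).trans (hs 0))
    have hindep : ∀ x ∈ K, ∀ y ∈ K, x + y * s 0 = 0 → x = 0 ∧ y = 0 := by
      intro x hx y hy h
      by_cases hy0 : y = 0
      · simpa [hy0] using h
      · refine absurd ?_ hnot
        have : s 0 = -x / y := by
          field_simp
          linear_combination h
        rw [this]
        exact div_mem (neg_mem hx) hy
    have hspan : ∀ z ∈ K', IsIntegral ℤ z → ∃ u ∈ K, ∃ v ∈ K,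
        IsIntegral ℤ u ∧ IsIntegral ℤ v ∧ z = u + v * ((1 + s 0) / 2) := by
      intro z hz hzi
      obtain ⟨x, hx, y, hy, rfl⟩ := hexists z hz
      exact hredq.exists_isIntegral_add_mul (hprime 0) (hmod 0) (hs 0) hx hy hzi
    have h2K : (2 : ℂ) ∈ K := ofNat_mem K 2
    rw [hfun]
    rcases hw 0 with ⟨hw0, hw1⟩ | ⟨hw0, hw1⟩
    · refine hbasis.cons hle ?_ ?_ ?_ ?_
      · rw [Fin.forall_fin_two, hw0, hw1]
        exact ⟨one_mem _, hα⟩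
      · rw [Fin.forall_fin_two, hw0, hw1]
        exact ⟨isIntegral_one, hαi⟩
      · intro x hx y hy h
        rw [hw0, hw1] at h
        obtain ⟨h1, h2⟩ := hindep (x + y / 2) (add_mem hx (div_mem hy h2K)) (y / 2)
          (div_mem hy h2K) (by linear_combination h)
        exact ⟨by linear_combination h1 - h2, by linear_combination 2 * h2⟩
      · intro z hz hzi
        obtain ⟨u, hu, v, hv, hui, hvi, rfl⟩ := hspan z hz hzi
        exact ⟨u, hu, v, hv, hui, hvi, by rw [hw0, hw1]; ring⟩
    · refine hbasis.cons hle ?_ ?_ ?_ ?_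
      · rw [Fin.forall_fin_two, hw0, hw1]
        exact ⟨hα, hβ⟩
      · rw [Fin.forall_fin_two, hw0, hw1]
        exact ⟨hαi, hβi⟩
      · intro x hx y hy h
        rw [hw0, hw1] at h
        obtain ⟨h1, h2⟩ := hindep ((x + y) / 2) (div_mem (add_mem hx hy) h2K) ((x - y) / 2)
          (div_mem (sub_mem hx hy) h2K) (by linear_combination h)
        exact ⟨by linear_combination h1 + h2, by linear_combination h1 - h2⟩
      · intro z hz hzi
        obtain ⟨u, hu, v, hv, hui, hvi, rfl⟩ := hspan z hz hzi
        exact ⟨u + v, add_mem hu hv, u, hu, hui.add hvi, hui, by rw [hw0, hw1]; ring⟩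

theorem stmt5 (r : ℕ) (qt : Fin r → ℤ) (hinj : Function.Injective qt)
    (hmod : ∀ i, qt i % 4 = 1)
    (hoddprime : ∀ i, Odd (qt i).natAbs ∧ (qt i).natAbs.Prime)
    (a abar : Fin r → ℂ)
    (ha : ∀ i, a i = (1 + csqrt (qt i : ℝ)) / 2)
    (habar : ∀ i, abar i = (1 - csqrt (qt i : ℝ)) / 2)
    -- `M = ℚ(√q̃_1, …, √q̃_r)` generated inside `ℂ`
    (M : IntermediateField ℚ ℂ)
    (hM : M = IntermediateField.adjoin ℚ (Set.range fun i => csqrt (qt i : ℝ)))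
    (e e' : (Fin r → Fin 2) → ℂ)
    (he : ∀ s, e s = ∏ i, a i ^ (s i : ℕ))
    (he' : ∀ s, e' s = ∏ i, abar i ^ (s i : ℕ) * a i ^ (1 - (s i : ℕ))) :
    IsIntBasis M e ∧ IsIntBasis M e' := by
  have hs (i : Fin r) : csqrt (qt i : ℝ) ^ 2 = (qt i : ℂ) := csqrt_intCast_sq _
  have hprime (i : Fin r) : Prime (qt i) := Int.prime_iff_natAbs_prime.mpr (hoddprime i).2
  have hcop : Pairwise fun i j => IsCoprime (qt i) (qt j) := by
    intro i j hij
    rw [Int.isCoprime_iff_gcd_eq_one, Int.gcd_def,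
      ← Nat.coprime_iff_gcd_eq_one, Nat.coprime_primes (hoddprime i).2 (hoddprime j).2]
    intro h
    have hne := hinj.ne hij
    have hi := hmod i
    have hj := hmod j
    omega
  subst hM
  constructor
  · convert (isIntBasis_adjoin_sqrt_and_reducedMod r qt _ hs hmod hprime hcop
      (fun i => ![1, a i]) (fun i => Or.inl (by simp [ha]))).1 using 1
    ext t
    rw [he]
    refine Finset.prod_congr rfl fun i _ => ?_
    generalize t i = b
    fin_cases b <;> simp
  · convert (isIntBasis_adjoin_sqrt_and_reducedMod r qt _ hs hmod hprime hcop
      (fun i => ![a i, abar i]) (fun i => Or.inr (by simp [ha, habar]))).1 using 1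
    ext t
    rw [he']
    refine Finset.prod_congr rfl fun i _ => ?_
    generalize t i = b
    fin_cases b <;> simp
end

section
/- Let d < 0 be a negative fundamental discriminant whose factorization into pairwise coprime prime discriminants d = q_1*·…·q_t* has all q_i* odd, numbered so that q_i* > 0 for 1 ≤ i ≤ u and q_i* < 0 for u < i ≤ t, where 0 ≤ u ≤ t−1. In ℂ set α_i = (1 + √q_i*)/2 and ᾱ_i = (1 − √q_i*)/2, and let K_G = ℚ(√q_1*, …, √q_t*) ⊂ ℂ with ring of integers 𝓞. For s ∈ {0,1}^{t−1} define β_s = (∏_{i=1}^{u} ᾱ_i^{s_i}·α_i^{1−s_i}) · ( (∏_{i=u+1}^{t−1} ᾱ_i^{s_i}·α_i^{1−s_i})·α_t + (∏_{i=u+1}^{t−1} ᾱ_i^{1−s_i}·α_i^{s_i})·ᾱ_t ) and β*_s = (∏_{i=1}^{u} (−ᾱ_i)^{s_i}·α_i^{1−s_i}) · ( (∏_{i=u+1}^{t−1} (−ᾱ_i)^{s_i}·α_i^{1−s_i})·α_t − (∏_{i=u+1}^{t−1} ᾱ_i^{1−s_i}·(−α_i)^{s_i})·ᾱ_t ). Then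 the 2^{t−1} numbers β_s form a ℤ-basis of the ring 𝓞 ∩ ℝ, and the 2^{t−1} numbers β*_s form a ℤ-basis of the ℤ-module 𝓞 ∩ iℝ. -/
/-- A prime discriminant. -/
def IsPrimeDiscriminant (q : ℤ) : Prop :=
  (∃ p : ℕ, p.Prime ∧ Odd p ∧ q = (-1) ^ ((p - 1) / 2) * (p : ℤ)) ∨
    q = -4 ∨ q = 8 ∨ q = -8

/-- A family `e` of complex numbers is a `ℤ`-basis of `𝓞 ∩ ℝ`, the ring of real elements
of the integral closure `𝓞` of `ℤ` in a subfield `M ⊂ ℂ`. -/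
def IsIntBasisReal {ι : Type*} (M : IntermediateField ℚ ℂ) (e : ι → ℂ) : Prop :=
  (∀ s, e s ∈ M) ∧ (∀ s, IsIntegral ℤ (e s)) ∧ (∀ s, (e s).im = 0) ∧
    LinearIndependent ℤ e ∧
    ∀ x : ℂ, x ∈ M → IsIntegral ℤ x → x.im = 0 → x ∈ Submodule.span ℤ (Set.range e)

/-- A family `e` of complex numbers is a `ℤ`-basis of the `ℤ`-module `𝓞 ∩ iℝ` of purely
imaginary elements of the integral closure `𝓞` of `ℤ` in a subfield `M ⊂ ℂ`. -/
def IsIntBasisImag {ι : Type*} (M : IntermediateField ℚ ℂ) (e : ι → ℂ) : Prop :=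
  (∀ s, e s ∈ M) ∧ (∀ s, IsIntegral ℤ (e s)) ∧ (∀ s, (e s).re = 0) ∧
    LinearIndependent ℤ e ∧
    ∀ x : ℂ, x ∈ M → IsIntegral ℤ x → x.re = 0 → x ∈ Submodule.span ℤ (Set.range e)

open IntermediateField in
theorem exists_add_mul_of_mem_adjoin_insert {F L : Type*} [Field F] [Field L] [Algebra F L]
    {A : Set L} {s : L} (hA : ∀ y ∈ A, ∃ c : F, y ^ 2 = algebraMap F L c)
    (hs : ∃ c : F, s ^ 2 = algebraMap F L c) {x : L} (hx : x ∈ adjoin F (insert s A)) :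
    ∃ u ∈ adjoin F A, ∃ v ∈ adjoin F A, x = u + v * s := by
  have halg : ∀ y ∈ insert s A, IsAlgebraic F y := by
    intro y hy
    obtain ⟨c, hc⟩ : ∃ c : F, y ^ 2 = algebraMap F L c := by
      rcases hy with rfl | hy
      exacts [hs, hA y hy]
    have : IsAlgebraic F (y ^ 2) := hc ▸ isAlgebraic_algebraMap c
    exact this.of_pow two_pos
  rw [← mem_toSubalgebra, adjoin_toSubalgebra_of_isAlgebraic halg] at hx
  obtain ⟨c, hc⟩ := hs
  induction hx using Algebra.adjoin_induction with
  | mem y hy =>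
    rcases hy with rfl | hy
    · exact ⟨0, zero_mem _, 1, one_mem _, by ring⟩
    · exact ⟨y, subset_adjoin F A hy, 0, zero_mem _, by ring⟩
  | algebraMap r => exact ⟨_, _root_.algebraMap_mem _ r, 0, zero_mem _, by ring⟩
  | add x y _ _ hx hy =>
    obtain ⟨u, hu, v, hv, rfl⟩ := hx
    obtain ⟨u', hu', v', hv', rfl⟩ := hy
    exact ⟨u + u', add_mem hu hu', v + v', add_mem hv hv', by ring⟩
  | mul x y _ _ hx hy =>
    obtain ⟨u, hu, v, hv, rfl⟩ := hx
    obtain ⟨u', hu', v', hv', rfl⟩ := hy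
    refine ⟨u * u' + v * v' * algebraMap F L c,
      add_mem (mul_mem hu hu') (mul_mem (mul_mem hv hv') (_root_.algebraMap_mem _ c)),
      u * v' + v * u', add_mem (mul_mem hu hv') (mul_mem hv hu'), ?_⟩
    rw [← hc]
    ring

open IntermediateField in
theorem exists_mul_prod_mem_bot_of_mem_adjoin {ι F L : Type*} [DecidableEq ι] [Field F]
    [NeZero (2 : F)] [Field L] [Algebra F L] {r : ι → L}
    (hr : ∀ i, ∃ c : F, r i ^ 2 = algebraMap F L c) (S : Finset ι) {x : L}
    (hx2 : ∃ c : F, x ^ 2 = algebraMap F L c) (hx : x ∈ adjoin F (r '' (S : Set ι))) :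
    ∃ T ⊆ S, ∃ c : F, x * ∏ i ∈ T, r i = algebraMap F L c := by
  induction S using Finset.induction_on generalizing x with
  | empty =>
    rw [Finset.coe_empty, Set.image_empty, adjoin_empty, mem_bot] at hx
    obtain ⟨c, hc⟩ := hx
    exact ⟨∅, subset_rfl, c, by simp [hc]⟩
  | insert j S hj ih =>
    by_cases hmem : x ∈ adjoin F (r '' (S : Set ι))
    · obtain ⟨T, hT, h⟩ := ih hx2 hmem
      exact ⟨T, hT.trans (Finset.subset_insert _ _), h⟩
    rw [Finset.coe_insert, Set.image_insert_eq] at hx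
    obtain ⟨u, hu, v, hv, rfl⟩ := exists_add_mul_of_mem_adjoin_insert
      (by rintro _ ⟨i, -, rfl⟩; exact hr i) (hr j) hx
    obtain ⟨c, hc⟩ := hx2
    obtain ⟨e, he⟩ := hr j
    have h2 : (2 : L) ≠ 0 := by
      rw [← map_ofNat (algebraMap F L) 2]
      exact (map_ne_zero _).2 (NeZero.ne _)
    have hv0 : v ≠ 0 := by
      rintro rfl
      exact hmem (by simpa using hu)
    have hu0 : u = 0 := by
      by_contra hu0
      have hrj : r j = (algebraMap F L c - u ^ 2 - v ^ 2 * algebraMap F L e) / (2 * u * v) := by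
        rw [← hc, ← he]
        field_simp
        ring
      have hrm : r j ∈ adjoin F (r '' (S : Set ι)) := by
        rw [hrj]
        exact div_mem (sub_mem (sub_mem (_root_.algebraMap_mem _ c) (pow_mem hu 2))
          (mul_mem (pow_mem hv 2) (_root_.algebraMap_mem _ e))) (mul_mem (mul_mem (ofNat_mem _ 2) hu) hv)
      exact hmem (add_mem hu (mul_mem hv hrm))
    subst hu0
    obtain ⟨T, hT, f, hf⟩ := ih (x := (0 + v * r j) * r j) ⟨c * e, by rw [mul_pow, hc, he, map_mul]⟩
      (by
        have : (0 + v * r j) * r j = v * algebraMap F L e := by rw [← he]; ring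
        rw [this]
        exact mul_mem hv (_root_.algebraMap_mem _ e))
    refine ⟨insert j T, Finset.insert_subset_insert _ hT, f, ?_⟩
    rw [Finset.prod_insert fun h => hj (hT h), ← hf]
    ring

theorem mem_range_intCast_of_isIntegral {L : Type*} [Field L] [CharZero L] {c : ℚ}
    (hc : IsIntegral ℤ (c : L)) : ∃ n : ℤ, (n : ℚ) = c := by
  have h : IsIntegral ℤ c := by
    refine (isIntegral_algHom_iff (algebraMap ℚ L).toIntAlgHom (algebraMap ℚ L).injective).1 ?_
    simpa using hc
  simpa using IsIntegrallyClosed.isIntegral_iff.1 h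

theorem exists_intCast_eq_of_sq_mul_squarefree {D : ℤ} (hD : Squarefree D) {c : ℚ} {n : ℤ}
    (h : c ^ 2 * D = n) : ∃ m : ℤ, (m : ℚ) = c := by
  have hD0 : (D : ℚ) ≠ 0 := by exact_mod_cast hD.ne_zero
  obtain ⟨k, hk⟩ : ∃ k : ℤ, (k : ℚ) = c * D := by
    have hint : IsIntegral ℤ (c * D) := by
      refine IsIntegral.of_pow two_pos ?_
      have : (c * D) ^ 2 = ((n * D : ℤ) : ℚ) := by push_cast; rw [← h]; ring
      rw [this]
      exact isIntegral_algebraMap (R := ℤ) (A := ℚ) (x := n * D)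
    simpa using IsIntegrallyClosed.isIntegral_iff.1 hint
  have hsq : k ^ 2 = n * D := by
    have : (k : ℚ) ^ 2 = n * D := by rw [hk, ← h]; ring
    exact_mod_cast this
  obtain ⟨m, rfl⟩ := (hD.dvd_pow_iff_dvd two_ne_zero).1 (Dvd.intro_left n hsq.symm)
  refine ⟨m, ?_⟩
  push_cast at hk
  exact mul_right_cancel₀ hD0 (by linarith)

open IntermediateField in
theorem not_mem_adjoin_of_squarefree_prod {ι L : Type*} [Fintype ι] [DecidableEq ι] [Field L]
    [Algebra ℚ L] {r : ι → L} {q : ι → ℤ} (hr : ∀ i, r i ^ 2 = q i)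
    (hsf : Squarefree (∏ i, q i)) (hq : ∀ i, ¬ IsUnit (q i)) (i : ι) (S : Finset ι) (hi : i ∉ S) :
    r i ∉ adjoin ℚ (r '' (S : Set ι)) := by
  have := algebraRat.charZero L
  intro hmem
  obtain ⟨T, hT, c, hc⟩ := exists_mul_prod_mem_bot_of_mem_adjoin
    (fun i => ⟨(q i : ℚ), by simp [hr]⟩) S ⟨(q i : ℚ), by simp [hr]⟩ hmem
  have hiT : i ∉ T := fun h => hi (hT h)
  rw [← Finset.prod_insert hiT] at hc
  have hsq : c ^ 2 = ((∏ j ∈ insert i T, q j : ℤ) : ℚ) := by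
    apply (algebraMap ℚ L).injective
    rw [map_pow, ← hc, ← Finset.prod_pow]
    simp [hr]
  obtain ⟨m, rfl⟩ := exists_intCast_eq_of_sq_mul_squarefree squarefree_one
    (c := c) (n := ∏ j ∈ insert i T, q j) (by rw [← hsq]; simp)
  have hm : m * m = ∏ j ∈ insert i T, q j := by
    rw [← sq]
    exact_mod_cast hsq
  have hu : IsUnit m := hsf m (hm ▸ Finset.prod_dvd_prod_of_subset _ _ _ (Finset.subset_univ _))
  exact hq i (isUnit_of_dvd_unit (Finset.dvd_prod_of_mem q (Finset.mem_insert_self i T))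
    (hm ▸ hu.mul hu))

open IntermediateField in
theorem isGalois_of_adjoin_sqrt {ι F L : Type*} [Finite ι] [Field F] [CharZero F] [Field L]
    [Algebra F L] {r : ι → L} (hr : ∀ i, ∃ c : F, r i ^ 2 = algebraMap F L c)
    (htop : adjoin F (Set.range r) = ⊤) : FiniteDimensional F L ∧ IsGalois F L := by
  have hint : ∀ i, IsIntegral F (r i) := fun i => IsIntegral.of_pow two_pos <| by
    obtain ⟨c, hc⟩ := hr i
    exact hc ▸ isIntegral_algebraMap
  have hfd : FiniteDimensional F L := by
    have : FiniteDimensional F (adjoin F (Set.range r)) :=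
      finiteDimensional_adjoin (by rintro _ ⟨i, rfl⟩; exact hint i)
    rw [htop] at this
    exact Module.Finite.equiv (topEquiv (F := F) (E := L)).toLinearEquiv
  have hnormal : Normal F L := by
    refine normal_iff.2 fun x => ⟨Algebra.IsIntegral.isIntegral x, ?_⟩
    have hx : x ∈ adjoin F (Set.range r) := by rw [htop]; exact mem_top
    refine splits_of_mem_adjoin F L (S := Set.range r) ?_ hx
    rintro _ ⟨i, rfl⟩
    refine ⟨hint i, ?_⟩
    obtain ⟨c, hc⟩ := hr i
    have hdvd : minpoly F (r i) ∣ Polynomial.X ^ 2 - Polynomial.C c := minpoly.dvd _ _ (by simp [hc])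
    have hfac : (Polynomial.X ^ 2 - Polynomial.C c).map (algebraMap F L) =
        (Polynomial.X - Polynomial.C (r i)) * (Polynomial.X - Polynomial.C (-r i)) := by
      simp only [Polynomial.map_sub, Polynomial.map_pow, Polynomial.map_X, Polynomial.map_C,
        ← hc, map_pow, map_neg]
      ring
    refine Polynomial.Splits.of_dvd (g := (Polynomial.X ^ 2 - Polynomial.C c).map (algebraMap F L)) ?_ ?_
      (Polynomial.map_dvd _ hdvd)
    · rw [hfac]
      exact (Polynomial.Splits.X_sub_C _).mul (Polynomial.Splits.X_sub_C _)
    · rw [hfac]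
      exact mul_ne_zero (Polynomial.X_sub_C_ne_zero _) (Polynomial.X_sub_C_ne_zero _)
  exact ⟨hfd, ⟨⟩⟩

open IntermediateField in
theorem exists_algEquiv_neg_sqrt {ι L : Type*} [Fintype ι] [DecidableEq ι] [Field L]
    [Algebra ℚ L] {r : ι → L} {q : ι → ℤ} (hr : ∀ i, r i ^ 2 = q i)
    (htop : adjoin ℚ (Set.range r) = ⊤)
    (hsf : Squarefree (∏ i, q i)) (hq : ∀ i, ¬ IsUnit (q i)) (i : ι) :
    ∃ τ : L ≃ₐ[ℚ] L, τ (r i) = -r i ∧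
      ∀ S : Finset ι, i ∉ S → ∀ x ∈ adjoin ℚ (r '' (S : Set ι)), τ x = x := by
  obtain ⟨_, _⟩ := isGalois_of_adjoin_sqrt (fun i => ⟨(q i : ℚ), by simp [hr]⟩) htop
  set F := adjoin ℚ (r '' ((Finset.univ.erase i : Finset ι) : Set ι)) with hF
  have hi : r i ∉ F := not_mem_adjoin_of_squarefree_prod hr hsf hq i _ (by simp)
  rw [← IsGalois.fixedField_fixingSubgroup F, mem_fixedField_iff] at hi
  push Not at hi
  obtain ⟨τ, hτ, hne⟩ := hi
  refine ⟨τ, ?_, fun S hS x hx => ?_⟩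
  · have : τ (r i) ^ 2 = r i ^ 2 := by rw [← map_pow, hr, map_intCast]
    exact (sq_eq_sq_iff_eq_or_eq_neg.1 this).resolve_left hne
  · refine (mem_fixingSubgroup_iff F τ).1 hτ x (adjoin.mono ℚ _ _ ?_ hx)
    exact Set.image_mono (Finset.coe_subset.2 fun j hj =>
      Finset.mem_erase.2 ⟨fun h => hS (h ▸ hj), Finset.mem_univ j⟩)

open IntermediateField in
theorem two_pow_card_le_finrank_of_adjoin_sqrt {ι L : Type*} [Fintype ι] [DecidableEq ι] [Field L]
    [Algebra ℚ L] {r : ι → L} {q : ι → ℤ} (hr : ∀ i, r i ^ 2 = q i)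
    (htop : adjoin ℚ (Set.range r) = ⊤)
    (hsf : Squarefree (∏ i, q i)) (hq : ∀ i, ¬ IsUnit (q i)) :
    2 ^ Fintype.card ι ≤ Module.finrank ℚ L := by
  have := algebraRat.charZero L
  obtain ⟨_, _⟩ := isGalois_of_adjoin_sqrt (fun i => ⟨(q i : ℚ), by simp [hr]⟩) htop
  have hex : ∀ T : Finset ι, ∃ g : L ≃ₐ[ℚ] L, ∀ i, g (r i) = if i ∈ T then -r i else r i := by
    intro T
    induction T using Finset.induction_on with
    | empty => exact ⟨1, by simp⟩
    | insert j T hj ih =>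
      obtain ⟨g, hg⟩ := ih
      obtain ⟨τ, hτ, hfix⟩ := exists_algEquiv_neg_sqrt hr htop hsf hq j
      have hfix' : ∀ i, i ≠ j → τ (r i) = r i := fun i hi =>
        hfix {i} (by simpa using hi.symm) _ (subset_adjoin _ _ (by simp))
      refine ⟨g.trans τ, fun i => ?_⟩
      rw [AlgEquiv.trans_apply, hg]
      by_cases hij : i = j
      · subst hij
        simp [hj, hτ]
      · by_cases hiT : i ∈ T <;> simp [hiT, hij, hfix' i hij]
  choose g hg using hex
  have hr0 : ∀ i, r i ≠ -r i := by
    intro i h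
    have h0 : r i = 0 := self_eq_neg.1 h
    have h1 := hr i
    rw [h0] at h1
    refine hsf.ne_zero (Finset.prod_eq_zero (Finset.mem_univ i) ?_)
    exact_mod_cast (by simpa using h1.symm : (q i : L) = 0)
  have hinj : Function.Injective g := by
    intro T T' h
    ext i
    have := congrArg (fun g => g (r i)) h
    simp only [hg] at this
    by_cases h1 : i ∈ T <;> by_cases h2 : i ∈ T' <;> simp_all [(hr0 i).symm]
  have := Nat.card_le_card_of_injective g hinj
  rwa [IsGalois.card_aut_eq_finrank, Nat.card_eq_fintype_card, Fintype.card_finset] at this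

theorem isIntegral_half_one_add_sqrt_s10 {L : Type*} [Field L] [CharZero L] {r : L} {q : ℤ}
    (hr : r ^ 2 = q) (hq : q % 4 = 1) : IsIntegral ℤ ((1 + r) / 2) := by
  obtain ⟨k, rfl⟩ : ∃ k, q = 4 * k + 1 := ⟨q / 4, by omega⟩
  refine ⟨.X ^ 2 - .X - .C k, by monicity!, ?_⟩
  rw [Polynomial.eval₂_sub, Polynomial.eval₂_sub, Polynomial.eval₂_pow, Polynomial.eval₂_X,
    Polynomial.eval₂_C, eq_intCast]
  push_cast at hr
  linear_combination hr / 4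

open IntermediateField in
theorem mem_span_prod_of_isIntegral_mul {ι L : Type*} [Fintype ι] [DecidableEq ι] [Field L]
    [Algebra ℚ L] {r a b : ι → L} {q : ι → ℤ} (hr : ∀ i, r i ^ 2 = q i)
    (htop : adjoin ℚ (Set.range r) = ⊤)
    (hsf : Squarefree (∏ i, q i)) (hq : ∀ i, ¬ IsUnit (q i)) (hq4 : ∀ i, q i % 4 = 1)
    (ha : ∀ i, a i = (1 + r i) / 2) (hb : ∀ i, b i = (1 - r i) / 2) (S : Finset ι) {x : L}
    (hx : x ∈ adjoin ℚ (r '' (S : Set ι))) (hint : IsIntegral ℤ (x * ∏ i ∈ Sᶜ, r i)) :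
    x ∈ Submodule.span ℤ (Set.range fun σ : ι → Fin 2 =>
      ∏ i ∈ S, b i ^ (σ i : ℕ) * a i ^ (1 - (σ i : ℕ))) := by
  have := algebraRat.charZero L
  induction S using Finset.induction_on generalizing x with
  | empty =>
    rw [Finset.coe_empty, Set.image_empty, adjoin_empty, mem_bot] at hx
    obtain ⟨c, rfl⟩ := hx
    have h2 := hint.pow 2
    rw [mul_pow, ← Finset.prod_pow, Finset.compl_empty] at h2
    simp only [hr] at h2
    obtain ⟨n, hn⟩ := mem_range_intCast_of_isIntegral (L := L) (c := c ^ 2 * (∏ i, q i : ℤ))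
      (by simpa using h2)
    obtain ⟨m, rfl⟩ := exists_intCast_eq_of_sq_mul_squarefree hsf hn.symm
    have := Submodule.smul_mem _ m (Submodule.subset_span (R := ℤ) (Set.mem_range_self
      (f := fun σ : ι → Fin 2 => ∏ i ∈ (∅ : Finset ι), b i ^ (σ i : ℕ) * a i ^ (1 - (σ i : ℕ))) 0))
    simpa using this
  | insert j S hj ih =>
    rw [Finset.coe_insert, Set.image_insert_eq] at hx
    obtain ⟨u, hu, v, hv, rfl⟩ := exists_add_mul_of_mem_adjoin_insert
      (by rintro _ ⟨i, -, rfl⟩; exact ⟨(q i : ℚ), by simp [hr]⟩) ⟨(q j : ℚ), by simp [hr]⟩ hx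
    obtain ⟨τ, hτ, hfix⟩ := exists_algEquiv_neg_sqrt hr htop hsf hq j
    have haj : IsIntegral ℤ (a j) := ha j ▸ isIntegral_half_one_add_sqrt_s10 (hr j) (hq4 j)
    have hbj : IsIntegral ℤ (b j) := by
      rw [hb, sub_eq_add_neg]
      exact isIntegral_half_one_add_sqrt_s10 (by rw [neg_sq, hr]) (hq4 j)
    have hP : τ (∏ i ∈ (insert j S)ᶜ, r i) = ∏ i ∈ (insert j S)ᶜ, r i := by
      refine hfix (insert j S)ᶜ (by simp) _ (prod_mem fun i hi => subset_adjoin _ _ ?_)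
      exact ⟨i, hi, rfl⟩
    have hcompl : ∏ i ∈ Sᶜ, r i = r j * ∏ i ∈ (insert j S)ᶜ, r i := by
      rw [Finset.compl_insert, Finset.mul_prod_erase _ _ (by simpa using hj)]
    have hconj : IsIntegral ℤ ((u - v * r j) * ∏ i ∈ (insert j S)ᶜ, r i) := by
      have := hint.map (τ : L →+* L).toIntAlgHom
      have heq : (τ : L →+* L).toIntAlgHom ((u + v * r j) * ∏ i ∈ (insert j S)ᶜ, r i) =
          (u - v * r j) * ∏ i ∈ (insert j S)ᶜ, r i := by
        change τ _ = _
        rw [map_mul, hP, map_add, map_mul, hτ, hfix S hj u hu, hfix S hj v hv, mul_neg,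
          sub_eq_add_neg]
      rwa [heq] at this
    have h1 := ih (add_mem hu hv) (by
      rw [hcompl]
      convert! (haj.mul hint).sub (hbj.mul hconj) using 1
      rw [ha, hb]
      ring)
    have h2 := ih (sub_mem hu hv) (by
      rw [hcompl]
      convert! (haj.mul hconj).sub (hbj.mul hint) using 1
      rw [ha, hb]
      ring)
    have hstep : ∀ k : Fin 2, ∀ y ∈ Submodule.span ℤ (Set.range fun σ : ι → Fin 2 =>
        ∏ i ∈ S, b i ^ (σ i : ℕ) * a i ^ (1 - (σ i : ℕ))),
        (b j ^ (k : ℕ) * a j ^ (1 - (k : ℕ))) * y ∈ Submodule.span ℤ (Set.range fun σ : ι → Fin 2 =>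
          ∏ i ∈ insert j S, b i ^ (σ i : ℕ) * a i ^ (1 - (σ i : ℕ))) := by
      intro k y hy
      induction hy using Submodule.span_induction with
      | mem y hy =>
        obtain ⟨σ, rfl⟩ := hy
        refine Submodule.subset_span ⟨Function.update σ j k, ?_⟩
        simp only [Finset.prod_insert hj, Function.update_self]
        congr 1
        refine Finset.prod_congr rfl fun i hi => ?_
        rw [Function.update_of_ne (by rintro rfl; exact hj hi)]
      | zero => simp
      | add y z _ _ hy hz => rw [mul_add]; exact add_mem hy hz
      | smul n y _ hy => rw [mul_smul_comm]; exact Submodule.smul_mem _ n hy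
    have := add_mem (hstep 0 _ h1) (hstep 1 _ h2)
    convert! this using 1
    simp [ha, hb]
    ring

open IntermediateField in
theorem linearIndependent_prod_of_adjoin_sqrt {ι L : Type*} [Fintype ι] [DecidableEq ι] [Field L]
    [Algebra ℚ L] {r a b : ι → L} {q : ι → ℤ} (hr : ∀ i, r i ^ 2 = q i)
    (htop : adjoin ℚ (Set.range r) = ⊤)
    (hsf : Squarefree (∏ i, q i)) (hq : ∀ i, ¬ IsUnit (q i)) (hq4 : ∀ i, q i % 4 = 1)
    (ha : ∀ i, a i = (1 + r i) / 2) (hb : ∀ i, b i = (1 - r i) / 2) :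
    LinearIndependent ℤ fun σ : ι → Fin 2 => ∏ i, b i ^ (σ i : ℕ) * a i ^ (1 - (σ i : ℕ)) := by
  obtain ⟨_, _⟩ := isGalois_of_adjoin_sqrt (fun i => ⟨(q i : ℚ), by simp [hr]⟩) htop
  rw [LinearIndependent.iff_fractionRing ℤ ℚ]
  refine linearIndependent_of_top_le_span_of_card_le_finrank ?_ ?_
  · intro x _
    obtain ⟨n, hn, hint⟩ := ((IsFractionRing.isAlgebraic_iff ℤ ℚ L).2
      (Algebra.IsAlgebraic.isAlgebraic (R := ℚ) x)).exists_integral_multiple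
    have hmem := mem_span_prod_of_isIntegral_mul hr htop hsf hq hq4 ha hb Finset.univ (x := n • x)
      (by rw [Finset.coe_univ, Set.image_univ, htop]; exact mem_top) (by simpa using hint)
    have hmem' := Submodule.span_le_restrictScalars ℤ ℚ _ hmem
    rw [Submodule.restrictScalars_mem] at hmem'
    have := Submodule.smul_mem _ (n : ℚ)⁻¹ hmem'
    rwa [← Int.cast_smul_eq_zsmul ℚ n x, smul_smul, inv_mul_cancel₀ (by exact_mod_cast hn), one_smul]
      at this
  · rw [Fintype.card_fun, Fintype.card_fin]
    exact two_pow_card_le_finrank_of_adjoin_sqrt hr htop hsf hq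

/-- If a linear involution exchanges the two halves `E₁`, `E₂` of a basis of a lattice, then
its `±1`-eigenvectors in the lattice are spanned by the sums, resp. differences, of
corresponding basis vectors (up to signs). -/
theorem linearIndependent_and_mem_span_of_conj {κ V : Type*} [Fintype κ] [AddCommGroup V]
    (E₁ E₂ : κ → V) (hE : LinearIndependent ℤ (Sum.elim E₁ E₂)) (conj : V →ₗ[ℤ] V)
    (h₁ : ∀ s, conj (E₁ s) = E₂ s) (h₂ : ∀ s, conj (E₂ s) = E₁ s) (η : ℤˣ) (ε : κ → ℤˣ)
    (e : κ → V) (he : ∀ s, e s = ε s • (E₁ s + η • E₂ s)) :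
    LinearIndependent ℤ e ∧ ∀ x ∈ Submodule.span ℤ (Set.range (Sum.elim E₁ E₂)),
      conj x = η • x → x ∈ Submodule.span ℤ (Set.range e) := by
  rw [Fintype.linearIndependent_iff] at hE
  constructor
  · rw [Fintype.linearIndependent_iff]
    intro g hg s
    have := hE (Sum.elim (fun s => g s * ε s) (fun s => g s * ε s * η)) (by
      rw [← hg, Fintype.sum_sum_type, ← Finset.sum_add_distrib]
      refine Finset.sum_congr rfl fun s _ => ?_
      simp [he, Units.smul_def, smul_add, smul_smul, mul_assoc]) (Sum.inl s)
    simpa using this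
  · intro x hx hconj
    obtain ⟨c, rfl⟩ := (Submodule.mem_span_range_iff_exists_fun ℤ).1 hx
    rw [Fintype.sum_sum_type] at hconj ⊢
    simp only [Sum.elim_inl, Sum.elim_inr, map_add, map_sum, map_smul, h₁, h₂] at hconj ⊢
    have hηη : (η : ℤ) * η = 1 := by rw [← Units.val_mul, Int.units_mul_self, Units.val_one]
    have hc : ∀ s, c (Sum.inr s) = η * c (Sum.inl s) := by
      intro s
      have := hE (Sum.elim (fun s => c (.inr s) - η * c (.inl s))
        (fun s => c (.inl s) - η * c (.inr s))) (by
          rw [Fintype.sum_sum_type]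
          simp only [Sum.elim_inl, Sum.elim_inr, sub_smul, mul_smul, Finset.sum_sub_distrib,
            ← Finset.smul_sum]
          rw [Units.smul_def, smul_add] at hconj
          rw [← sub_eq_zero] at hconj
          rw [← hconj]
          abel) (Sum.inl s)
      simpa [sub_eq_zero] using this
    rw [← Finset.sum_add_distrib]
    refine sum_mem fun s _ => ?_
    have : c (.inl s) • E₁ s + c (.inr s) • E₂ s = (c (.inl s) * ε s) • e s := by
      have hεε : (ε s : ℤ) * ε s = 1 := by
        rw [← Units.val_mul, Int.units_mul_self, Units.val_one]
      rw [he, hc, Units.smul_def, Units.smul_def, smul_smul, mul_assoc, hεε, mul_one, smul_add,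
        smul_smul, mul_comm (η : ℤ)]
    rw [this]
    exact Submodule.smul_mem _ _ (Submodule.subset_span ⟨s, rfl⟩)

open IntermediateField in
theorem linearIndependent_and_mem_span_prod_of_eq_adjoin {ι L : Type*} [Fintype ι] [DecidableEq ι]
    [Field L] [Algebra ℚ L] {r a b : ι → L} {q : ι → ℤ} (hr : ∀ i, r i ^ 2 = q i)
    {K : IntermediateField ℚ L} (hK : K = adjoin ℚ (Set.range r))
    (hsf : Squarefree (∏ i, q i)) (hq : ∀ i, ¬ IsUnit (q i)) (hq4 : ∀ i, q i % 4 = 1)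
    (ha : ∀ i, a i = (1 + r i) / 2) (hb : ∀ i, b i = (1 - r i) / 2) :
    LinearIndependent ℤ (fun σ : ι → Fin 2 => ∏ i, b i ^ (σ i : ℕ) * a i ^ (1 - (σ i : ℕ))) ∧
      ∀ x ∈ K, IsIntegral ℤ x → x ∈ Submodule.span ℤ (Set.range fun σ : ι → Fin 2 =>
        ∏ i, b i ^ (σ i : ℕ) * a i ^ (1 - (σ i : ℕ))) := by
  let _ : Algebra ℚ K := K.algebra'
  have hrK : ∀ i, r i ∈ K := fun i => hK ▸ subset_adjoin _ _ ⟨i, rfl⟩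
  set r' : ι → K := fun i => ⟨r i, hrK i⟩
  have hr' : ∀ i, r' i ^ 2 = q i := fun i => Subtype.ext (by simpa using hr i)
  have htop : adjoin ℚ (Set.range r') = ⊤ := by
    apply map_injective K.val
    rw [adjoin_map, ← AlgHom.fieldRange_eq_map, fieldRange_val, ← Set.range_comp]
    exact hK.symm
  have hfun : (fun σ : ι → Fin 2 => ∏ i, b i ^ (σ i : ℕ) * a i ^ (1 - (σ i : ℕ))) =
      K.val.toLinearMap.restrictScalars ℤ ∘ fun σ : ι → Fin 2 =>
        ∏ i, ((1 - r' i) / 2) ^ (σ i : ℕ) * ((1 + r' i) / 2) ^ (1 - (σ i : ℕ)) := by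
    funext σ
    change _ = K.val _
    simp only [map_prod, map_mul, map_pow, map_div₀, map_sub, map_add, map_one, map_ofNat, ha, hb]
    rfl
  rw [hfun]
  constructor
  · refine (linearIndependent_prod_of_adjoin_sqrt hr' htop hsf hq hq4 (fun _ => rfl)
      (fun _ => rfl)).map' _ (LinearMap.ker_eq_bot.2 ?_)
    exact K.val.injective
  · intro x hx hint
    have hint' : IsIntegral ℤ (⟨x, hx⟩ : K) :=
      (isIntegral_algHom_iff (K.val.restrictScalars ℤ) K.val.injective).1 hint
    have := mem_span_prod_of_isIntegral_mul hr' htop hsf hq hq4 (fun _ => rfl) (fun _ => rfl)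
      Finset.univ (x := ⟨x, hx⟩)
      (by rw [Finset.coe_univ, Set.image_univ, htop]; exact mem_top) (by simpa using hint')
    rw [Set.range_comp, Submodule.span_image]
    exact ⟨_, this, rfl⟩

theorem conj_csqrt_of_pos {x : ℝ} (hx : 0 < x) : starRingEnd ℂ (csqrt x) = csqrt x := by
  rw [csqrt, if_neg hx.not_gt, Complex.conj_ofReal]

theorem IsPrimeDiscriminant.emod_four_and_not_isUnit {q : ℤ} (hq : IsPrimeDiscriminant q)
    (hodd : Odd q) : q % 4 = 1 ∧ ¬ IsUnit q := by
  rcases hq with ⟨p, hp, ⟨k, rfl⟩, rfl⟩ | rfl | rfl | rfl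
  · constructor
    · rw [show (2 * k + 1 - 1) / 2 = k by omega]
      rcases Nat.even_or_odd k with hk | hk
      · rw [hk.neg_one_pow]
        obtain ⟨m, rfl⟩ := hk
        push_cast
        omega
      · rw [hk.neg_one_pow]
        obtain ⟨m, rfl⟩ := hk
        push_cast
        omega
    · rw [Int.isUnit_iff_natAbs_eq, Int.natAbs_mul, Int.natAbs_pow, Int.natAbs_neg,
        Int.natAbs_one, one_pow, one_mul, Int.natAbs_natCast]
      exact hp.ne_one
  all_goals exact absurd hodd (by decide)

theorem prod_ite_mul_prod_ite_not {ι M : Type*} [Fintype ι] [CommMonoid M] (p p' : ι → Prop)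
    [DecidablePred p] [DecidablePred p'] (hp : ∀ i, p' i ↔ ¬ p i) (f g : ι → M) :
    (∏ i, if p i then f i else 1) * (∏ i, if p' i then g i else 1) =
      ∏ i, if p i then f i else g i := by
  rw [← Finset.prod_mul_distrib]
  refine Finset.prod_congr rfl fun i _ => ?_
  by_cases h : p i <;> simp [hp, h]

/- Here `t = t' + 1`: the (1-based) indices `1, …, t−1` correspond to `i.castSucc` for
`i : Fin t'`, and the index `t` corresponds to `Fin.last t'`; sets `s ∈ {0,1}^{t−1}`
are functions `s : Fin t' → Fin 2`. -/
theorem stmt10 (t' : ℕ) (d : ℤ) (hd : IsNegFundamentalDiscriminant d)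
    (Q : Fin (t' + 1) → ℤ) (hQ : ∀ i, IsPrimeDiscriminant (Q i))
    (hcop : Pairwise fun i j => IsCoprime (Q i) (Q j)) (hprod : d = ∏ i, Q i)
    (hodd : ∀ i, Odd (Q i))
    (u : ℕ) (hu : u ≤ t')
    (hsign : ∀ i : Fin (t' + 1), ((i : ℕ) < u → 0 < Q i) ∧ (u ≤ (i : ℕ) → Q i < 0))
    (a abar : Fin (t' + 1) → ℂ)
    (ha : ∀ i, a i = (1 + csqrt (Q i : ℝ)) / 2)
    (habar : ∀ i, abar i = (1 - csqrt (Q i : ℝ)) / 2)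
    -- `K_G = ℚ(√q_1*, …, √q_t*)` generated inside `ℂ`
    (K : IntermediateField ℚ ℂ)
    (hK : K = IntermediateField.adjoin ℚ (Set.range fun i => csqrt (Q i : ℝ)))
    (β βstar : (Fin t' → Fin 2) → ℂ)
    (hβ : ∀ s, β s =
      (∏ i : Fin t', if (i : ℕ) < u then
          abar i.castSucc ^ (s i : ℕ) * a i.castSucc ^ (1 - (s i : ℕ)) else 1) *
        ((∏ i : Fin t', if u ≤ (i : ℕ) then
            abar i.castSucc ^ (s i : ℕ) * a i.castSucc ^ (1 - (s i : ℕ)) else 1) *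
            a (Fin.last t') +
         (∏ i : Fin t', if u ≤ (i : ℕ) then
            abar i.castSucc ^ (1 - (s i : ℕ)) * a i.castSucc ^ (s i : ℕ) else 1) *
            abar (Fin.last t')))
    (hβstar : ∀ s, βstar s =
      (∏ i : Fin t', if (i : ℕ) < u then
          (-abar i.castSucc) ^ (s i : ℕ) * a i.castSucc ^ (1 - (s i : ℕ)) else 1) *
        ((∏ i : Fin t', if u ≤ (i : ℕ) then
            (-abar i.castSucc) ^ (s i : ℕ) * a i.castSucc ^ (1 - (s i : ℕ)) else 1) *
            a (Fin.last t') -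
         (∏ i : Fin t', if u ≤ (i : ℕ) then
            abar i.castSucc ^ (1 - (s i : ℕ)) * (-a i.castSucc) ^ (s i : ℕ) else 1) *
            abar (Fin.last t'))) :
    IsIntBasisReal K β ∧ IsIntBasisImag K βstar := by
  set r : Fin (t' + 1) → ℂ := fun i => csqrt (Q i : ℝ) with hr_def
  have hr : ∀ i, r i ^ 2 = Q i := fun i => by simp [hr_def, csqrt_sq]
  have hq4 : ∀ i, Q i % 4 = 1 := fun i => ((hQ i).emod_four_and_not_isUnit (hodd i)).1
  have hsf : Squarefree (∏ i, Q i) := by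
    rcases hd.2 with h | h
    · exact hprod ▸ h.2
    · have : Odd d := hprod ▸ Finset.prod_induction Q Odd (fun _ _ => Odd.mul) odd_one
        fun i _ => hodd i
      rw [Int.odd_iff] at this
      omega
  obtain ⟨hlin, hspan⟩ := linearIndependent_and_mem_span_prod_of_eq_adjoin hr hK hsf
    (fun i => ((hQ i).emod_four_and_not_isUnit (hodd i)).2) hq4 ha habar
  have hconja : ∀ i, starRingEnd ℂ (a i) = if (i : ℕ) < u then a i else abar i := by
    intro i
    split_ifs with hi
    · have hpos : (0 : ℝ) < Q i := by exact_mod_cast (hsign i).1 hi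
      simp [ha, conj_csqrt_of_pos hpos, map_ofNat]
    · have hneg : (Q i : ℝ) < 0 := by exact_mod_cast (hsign i).2 (not_lt.1 hi)
      simp [ha, habar, conj_csqrt_of_neg hneg, map_ofNat, sub_eq_add_neg]
  have hconjb : ∀ i, starRingEnd ℂ (abar i) = if (i : ℕ) < u then abar i else a i := by
    intro i
    split_ifs with hi
    · have hpos : (0 : ℝ) < Q i := by exact_mod_cast (hsign i).1 hi
      simp [habar, conj_csqrt_of_pos hpos, map_ofNat]
    · have hneg : (Q i : ℝ) < 0 := by exact_mod_cast (hsign i).2 (not_lt.1 hi)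
      simp [ha, habar, conj_csqrt_of_neg hneg, map_ofNat]
  have hlast : ¬ ((Fin.last t' : Fin (t' + 1)) : ℕ) < u := by simpa using hu
  let E₁ : (Fin t' → Fin 2) → ℂ := fun s =>
    (∏ i : Fin t', abar i.castSucc ^ (s i : ℕ) * a i.castSucc ^ (1 - (s i : ℕ))) * a (Fin.last t')
  let E₂ : (Fin t' → Fin 2) → ℂ := fun s =>
    (∏ i : Fin t', if (i : ℕ) < u then abar i.castSucc ^ (s i : ℕ) * a i.castSucc ^ (1 - (s i : ℕ))
      else abar i.castSucc ^ (1 - (s i : ℕ)) * a i.castSucc ^ (s i : ℕ)) * abar (Fin.last t')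
  let flip : (Fin t' → Fin 2) → Fin t' → Fin 2 := fun s i => if (i : ℕ) < u then s i else 1 - s i
  have hflip : Function.Involutive flip := by
    intro s
    funext i
    by_cases hi : (i : ℕ) < u <;> simp [flip, hi]
  let φ : (Fin t' → Fin 2) ⊕ (Fin t' → Fin 2) → Fin (t' + 1) → Fin 2 :=
    Sum.elim (fun s => Fin.snoc (α := fun _ => Fin 2) s 0)
      (fun s => Fin.snoc (α := fun _ => Fin 2) (flip s) 1)
  have hφinj : Function.Injective φ := by
    rintro (s | s) (s' | s') h
    · exact congrArg Sum.inl (Fin.snoc_injective2 (α := fun _ => Fin 2) h).1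
    · exact absurd (Fin.snoc_injective2 (α := fun _ => Fin 2) h).2 (by decide)
    · exact absurd (Fin.snoc_injective2 (α := fun _ => Fin 2) h).2 (by decide)
    · exact congrArg Sum.inr (hflip.injective (Fin.snoc_injective2 (α := fun _ => Fin 2) h).1)
  have hφ : Function.Bijective φ := by
    refine (Fintype.bijective_iff_injective_and_card φ).2 ⟨hφinj, ?_⟩
    simp [pow_succ, mul_two]
  have hE : Sum.elim E₁ E₂ =
      (fun σ : Fin (t' + 1) → Fin 2 => ∏ i, abar i ^ (σ i : ℕ) * a i ^ (1 - (σ i : ℕ))) ∘ φ := by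
    funext s
    rcases s with s | s
    · simp [E₁, φ, Fin.prod_univ_castSucc]
    · simp only [Sum.elim_inr, E₂, φ, Function.comp_apply, Fin.prod_univ_castSucc, Fin.snoc_castSucc,
        Fin.snoc_last]
      congr 1
      · refine Finset.prod_congr rfl fun i _ => ?_
        by_cases hi : (i : ℕ) < u
        · simp [flip, hi]
        · simp only [flip, if_neg hi]
          generalize s i = k
          fin_cases k <;> simp
      · simp
  have hElin : LinearIndependent ℤ (Sum.elim E₁ E₂) := hE ▸ hlin.comp φ hφ.injective
  have hEspan : Set.range (Sum.elim E₁ E₂) = Set.range fun σ : Fin (t' + 1) → Fin 2 =>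
      ∏ i, abar i ^ (σ i : ℕ) * a i ^ (1 - (σ i : ℕ)) := by
    rw [hE, hφ.surjective.range_comp]
  have hconj₁ : ∀ s, starRingEnd ℂ (E₁ s) = E₂ s := by
    intro s
    simp only [E₁, E₂, map_mul, map_prod, map_pow, hconja, hconjb, if_neg hlast]
    congr 1
    refine Finset.prod_congr rfl fun i _ => ?_
    by_cases hi : (i : ℕ) < u <;> simp [hi, mul_comm]
  have hconj₂ : ∀ s, starRingEnd ℂ (E₂ s) = E₁ s := by
    intro s
    rw [← hconj₁, Complex.conj_conj]
  let conj : ℂ →ₗ[ℤ] ℂ := (starRingEnd ℂ).toAddMonoidHom.toIntLinearMap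
  have hle : ∀ i : ℕ, u ≤ i ↔ ¬ i < u := fun i => not_lt.symm
  have hβE : ∀ s, β s = E₁ s + E₂ s := by
    intro s
    rw [hβ, mul_add, ← mul_assoc, ← mul_assoc, prod_ite_mul_prod_ite_not _ _ (fun _ => hle _),
      prod_ite_mul_prod_ite_not _ _ (fun _ => hle _)]
    simp only [ite_self, E₁, E₂]
  have hβstarE : ∀ s, βstar s = (∏ i, (-1 : ℤˣ) ^ (s i : ℕ)) • (E₁ s - E₂ s) := by
    intro s
    rw [hβstar, mul_sub, ← mul_assoc, ← mul_assoc, prod_ite_mul_prod_ite_not _ _ (fun _ => hle _),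
      prod_ite_mul_prod_ite_not _ _ (fun _ => hle _)]
    simp only [ite_self, E₁, E₂, Units.smul_def, zsmul_eq_mul, mul_sub, ← mul_assoc,
      Units.coe_prod, Units.val_pow_eq_pow_val, Units.val_neg, Units.val_one, Int.cast_prod,
      Int.cast_pow, Int.cast_neg, Int.cast_one, ← Finset.prod_mul_distrib]
    congr 2
    · refine Finset.prod_congr rfl fun i _ => ?_
      rw [neg_pow]
    · refine Finset.prod_congr rfl fun i _ => ?_
      split_ifs
      · rw [neg_pow, mul_assoc]
      · rw [neg_pow (a i.castSucc)]
        ring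
  have hrK : ∀ i, r i ∈ K := fun i => hK ▸ IntermediateField.subset_adjoin _ _ ⟨i, rfl⟩
  have haO : ∀ i, a i ∈ K ∧ IsIntegral ℤ (a i) := fun i =>
    ⟨ha i ▸ div_mem (add_mem (one_mem _) (hrK i)) (ofNat_mem K 2),
      ha i ▸ isIntegral_half_one_add_sqrt_s10 (hr i) (hq4 i)⟩
  have hbO : ∀ i, abar i ∈ K ∧ IsIntegral ℤ (abar i) := fun i =>
    ⟨habar i ▸ div_mem (sub_mem (one_mem _) (hrK i)) (ofNat_mem K 2), by
      rw [habar, sub_eq_add_neg]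
      exact isIntegral_half_one_add_sqrt_s10 (by rw [neg_sq]; exact hr i) (hq4 i)⟩
  let O : Subring ℂ := K.toSubfield.toSubring ⊓ (integralClosure ℤ ℂ).toSubring
  have hO₁ : ∀ s, E₁ s ∈ O := fun s => mul_mem
    (prod_mem fun i _ => mul_mem (pow_mem (hbO _) _) (pow_mem (haO _) _)) (haO _)
  have hO₂ : ∀ s, E₂ s ∈ O := by
    refine fun s => mul_mem (prod_mem fun i _ => ?_) (hbO _)
    split_ifs <;> exact mul_mem (pow_mem (hbO _) _) (pow_mem (haO _) _)
  have hβO : ∀ s, β s ∈ O := fun s => hβE s ▸ add_mem (hO₁ s) (hO₂ s)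
  have hβstarO : ∀ s, βstar s ∈ O := fun s =>
    hβstarE s ▸ zsmul_mem (sub_mem (hO₁ s) (hO₂ s)) _
  obtain ⟨hlinβ, hspanβ⟩ := linearIndependent_and_mem_span_of_conj E₁ E₂ hElin conj hconj₁ hconj₂
    1 1 β (fun s => by simp [hβE])
  obtain ⟨hlinβ', hspanβ'⟩ := linearIndependent_and_mem_span_of_conj E₁ E₂ hElin conj hconj₁ hconj₂
    (-1) (fun s => ∏ i, (-1) ^ (s i : ℕ)) βstar
    (fun s => by rw [hβstarE, Units.neg_smul, one_smul, sub_eq_add_neg])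
  refine ⟨⟨fun s => (hβO s).1, fun s => (hβO s).2, fun s => ?_, hlinβ, fun x hx hint him => ?_⟩,
    ⟨fun s => (hβstarO s).1, fun s => (hβstarO s).2, fun s => ?_, hlinβ', fun x hx hint hre => ?_⟩⟩
  · rw [← Complex.conj_eq_iff_im, hβE, map_add, hconj₁, hconj₂, add_comm]
  · refine hspanβ x (hEspan ▸ hspan x hx hint) ?_
    rw [one_smul]
    exact Complex.conj_eq_iff_im.2 him
  · have h : starRingEnd ℂ (βstar s) = -βstar s := by
      rw [hβstarE, Units.smul_def, map_zsmul, map_sub, hconj₁, hconj₂, ← smul_neg, neg_sub]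
    have := congrArg Complex.re h
    rw [Complex.conj_re, Complex.neg_re] at this
    linarith
  · refine hspanβ' x (hEspan ▸ hspan x hx hint) ?_
    rw [Units.neg_smul, one_smul]
    change starRingEnd ℂ x = -x
    apply Complex.ext <;> simp [hre]
end

section
/- Let d < 0 be a negative fundamental discriminant whose factorization into pairwise coprime prime discriminants d = q_1*·…·q_t* has all q_i* odd, numbered so that q_i* > 0 for 1 ≤ i ≤ u and q_i* < 0 for u < i ≤ t, where 0 ≤ u ≤ t−1. Define α_i, ᾱ_i, β_s, β*_s as follows: α_i = (1 + √q_i*)/2, ᾱ_i = (1 − √q_i*)/2 in ℂ, and for s ∈ {0,1}^{t−1}, β_s = (∏_{i=1}^{u} ᾱ_i^{s_i}·α_i^{1−s_i}) · ( (∏_{i=u+1}^{t−1} ᾱ_i^{s_i}·α_i^{1−s_i})·α_t + (∏_{i=u+1}^{t−1} ᾱ_i^{1−s_i}·α_i^{s_i})·ᾱ_t ), β*_s = (∏_{i=1}^{u} (−ᾱ_i)^{s_i}·α_i^{1−s_i}) · ( (∏_{i=u+1}^{t−1} (−ᾱ_i)^{s_i}·α_i^{1−s_i})·α_t − (∏_{i=u+1}^{t−1}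 ᾱ_i^{1−s_i}·(−α_i)^{s_i})·ᾱ_t ). Let K_G = ℚ(√q_1*, …, √q_t*) ⊂ ℂ, and for each μ ∈ {0,1}^{t−1} let τ_μ be a ℚ-algebra automorphism of K_G with τ_μ(√q_i*) = (−1)^{μ_i}·√q_i* for 1 ≤ i ≤ t−1 and τ_μ(√q_t*) = √q_t*. Then for all η, ν ∈ {0,1}^{t−1}: ∑_{μ ∈ {0,1}^{t−1}} (−1)^{μ_1+…+μ_{t−1}} · τ_μ(β_η · β*_ν) equals √q_1*·…·√q_t* (a square root of d) if η = ν, and equals 0 otherwise. -/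
section GenusBasis

variable {F L : Type*} [Field F] [Field L]

/-- The conjugate `(1 ± r) / 2`, with sign `(-1) ^ n`. -/
def halfConj (r : F) (n : ℕ) : F := (1 + (-1) ^ n * r) / 2

lemma map_halfConj (f : F →+* L) (r : F) (n : ℕ) :
    f (halfConj r n) = halfConj (f r) n := by
  simp [halfConj, map_ofNat f 2]

lemma halfConj_neg_one_pow_mul (r : F) (m n : ℕ) :
    halfConj ((-1) ^ m * r) n = halfConj r (n + m) := by
  simp only [halfConj, pow_add]
  ring

lemma sum_neg_one_pow_mul_halfConj [NeZero (2 : F)] (r : F) (p q : ℕ) :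
    ∑ m : Fin 2, (-1) ^ (m : ℕ) * (halfConj r (p + m) * halfConj r (q + m)) =
      r * (((-1) ^ p + (-1) ^ q) / 2) := by
  have h2 : (2 : F) ≠ 0 := NeZero.ne 2
  simp only [Fin.sum_univ_two, halfConj, pow_add, Fin.val_zero, Fin.val_one, pow_zero, pow_one]
  field_simp
  ring

/-- The element `β_s` as a function of the square roots `r` and the indicator `e` of the
negative prime discriminants. -/
def genusBeta {n : ℕ} (e : Fin n → ℕ) (r : Fin (n + 1) → F) (s : Fin n → Fin 2) : F :=
  ∑ δ : Fin 2, (∏ i, halfConj (r i.castSucc) (s i + δ * e i)) * halfConj (r (Fin.last n)) δ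

/-- The element `β*_s` as a function of the square roots `r` and the indicator `e` of the
negative prime discriminants. -/
def genusBetaStar {n : ℕ} (e : Fin n → ℕ) (r : Fin (n + 1) → F) (s : Fin n → Fin 2) : F :=
  ∑ ε : Fin 2, (∏ i, (-1) ^ (s i : ℕ) * halfConj (r i.castSucc) (s i + ε * e i)) *
    ((-1) ^ (ε : ℕ) * halfConj (r (Fin.last n)) ε)

lemma map_genusBeta {n : ℕ} (f : F →+* L) (e : Fin n → ℕ) (r : Fin (n + 1) → F)
    (s : Fin n → Fin 2) : f (genusBeta e r s) = genusBeta e (fun i => f (r i)) s := by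
  simp [genusBeta, map_halfConj]

lemma map_genusBetaStar {n : ℕ} (f : F →+* L) (e : Fin n → ℕ) (r : Fin (n + 1) → F)
    (s : Fin n → Fin 2) : f (genusBetaStar e r s) = genusBetaStar e (fun i => f (r i)) s := by
  simp [genusBetaStar, map_halfConj]

lemma prod_one_add_neg_one_pow_div_two [NeZero (2 : F)] {n : ℕ} (η ν : Fin n → Fin 2) :
    ∏ i, ((1 + (-1) ^ (η i : ℕ) * (-1) ^ (ν i : ℕ)) / 2 : F) = if η = ν then 1 else 0 := by
  have h2 : (2 : F) ≠ 0 := NeZero.ne 2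
  have key : ∀ x y : Fin 2,
      ((1 + (-1) ^ (x : ℕ) * (-1) ^ (y : ℕ)) / 2 : F) = if x = y then 1 else 0 := by
    intro x y
    fin_cases x <;> fin_cases y <;> simp [one_add_one_eq_two, h2]
  simp only [key, Finset.prod_ite_zero, Finset.prod_const_one, Finset.mem_univ, true_imp_iff,
    funext_iff]

/-- Duality of `genusBeta` and `genusBetaStar` under the twisted trace form, for arbitrary
square roots `r` and an even number of negative prime discriminants among the first `n`. -/
lemma sum_genusBeta_mul_genusBetaStar [NeZero (2 : F)] {n : ℕ} (e : Fin n → ℕ)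
    (he : ∏ i, (-1 : F) ^ e i = 1) (r : Fin (n + 1) → F) (σ : (Fin n → Fin 2) → Fin (n + 1) → F)
    (hσ : ∀ μ i, σ μ i.castSucc = (-1) ^ (μ i : ℕ) * r i.castSucc)
    (hσlast : ∀ μ, σ μ (Fin.last n) = r (Fin.last n)) (η ν : Fin n → Fin 2) :
    ∑ μ : Fin n → Fin 2, (-1) ^ (∑ i, (μ i : ℕ)) *
        (genusBeta e (σ μ) η * genusBetaStar e (σ μ) ν) =
      if η = ν then ∏ i, r i else 0 := by
  have h2 : (2 : F) ≠ 0 := NeZero.ne 2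
  have hprod : ∀ δ ε : Fin 2, ∑ μ : Fin n → Fin 2, (-1) ^ (∑ i, (μ i : ℕ)) *
      ((∏ i, halfConj (σ μ i.castSucc) (η i + δ * e i)) *
        ∏ i, (-1) ^ (ν i : ℕ) * halfConj (σ μ i.castSucc) (ν i + ε * e i)) =
      ∏ i, (r i.castSucc * (((-1) ^ (η i : ℕ) * (-1) ^ (ν i : ℕ) * (-1) ^ (δ * e i : ℕ) +
        (-1) ^ (ε * e i : ℕ)) / 2)) := by
    intro δ ε
    calc _ = ∑ μ : Fin n → Fin 2, ∏ i, (-1) ^ (ν i : ℕ) * ((-1) ^ (μ i : ℕ) *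
          (halfConj (r i.castSucc) (η i + δ * e i + μ i) *
            halfConj (r i.castSucc) (ν i + ε * e i + μ i))) := by
          refine Finset.sum_congr rfl fun μ _ => ?_
          rw [← Finset.prod_pow_eq_pow_sum, ← Finset.prod_mul_distrib, ← Finset.prod_mul_distrib]
          refine Finset.prod_congr rfl fun i _ => ?_
          rw [hσ, halfConj_neg_one_pow_mul, halfConj_neg_one_pow_mul]
          ring
      _ = ∏ i, ∑ m : Fin 2, (-1) ^ (ν i : ℕ) * ((-1) ^ (m : ℕ) *
          (halfConj (r i.castSucc) (η i + δ * e i + m) *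
            halfConj (r i.castSucc) (ν i + ε * e i + m))) := by
          rw [Finset.prod_univ_sum, Fintype.piFinset_univ]
      _ = _ := by
          refine Finset.prod_congr rfl fun i _ => ?_
          rw [← Finset.mul_sum, sum_neg_one_pow_mul_halfConj, pow_add, pow_add]
          have hν : (-1 : F) ^ (ν i : ℕ) * (-1) ^ (ν i : ℕ) = 1 := by
            rw [← mul_pow]; simp
          linear_combination (r i.castSucc * (-1) ^ (ε * e i : ℕ) / 2) * hν
  set P : Fin 2 → Fin 2 → F := fun δ ε =>
    ∏ i, (r i.castSucc * (((-1) ^ (η i : ℕ) * (-1) ^ (ν i : ℕ) * (-1) ^ (δ * e i : ℕ) +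
        (-1) ^ (ε * e i : ℕ)) / 2)) with hP
  have htotal : ∑ μ : Fin n → Fin 2, (-1) ^ (∑ i, (μ i : ℕ)) *
        (genusBeta e (σ μ) η * genusBetaStar e (σ μ) ν) =
      ∑ δ : Fin 2, ∑ ε : Fin 2, P δ ε * (halfConj (r (Fin.last n)) δ *
        ((-1) ^ (ε : ℕ) * halfConj (r (Fin.last n)) ε)) := by
    simp only [hP, ← hprod, genusBeta, genusBetaStar, hσlast, Finset.sum_mul_sum]
    simp only [Finset.mul_sum, Finset.sum_mul]
    rw [Finset.sum_comm]
    refine Finset.sum_congr rfl fun δ _ => ?_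
    rw [Finset.sum_comm]
    refine Finset.sum_congr rfl fun ε _ => Finset.sum_congr rfl fun μ _ => ?_
    ring
  have h00 : P 0 0 = (∏ i : Fin n, r i.castSucc) * if η = ν then 1 else 0 := by
    rw [← prod_one_add_neg_one_pow_div_two (F := F), ← Finset.prod_mul_distrib]
    refine Finset.prod_congr rfl fun i _ => ?_
    simp [add_comm]
  have hflip : ∀ δ ε δ' ε' : Fin 2, (∀ i, (-1 : F) ^ (δ' * e i : ℕ) =
      (-1) ^ e i * (-1) ^ (δ * e i : ℕ)) → (∀ i, (-1 : F) ^ (ε' * e i : ℕ) =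
      (-1) ^ e i * (-1) ^ (ε * e i : ℕ)) → P δ' ε' = P δ ε := by
    intro δ ε δ' ε' hδ hε
    rw [← one_mul (P δ ε), ← he, hP]
    simp only
    rw [← Finset.prod_mul_distrib]
    refine Finset.prod_congr rfl fun i _ => ?_
    rw [hδ, hε]
    ring
  have hsq : ∀ i, (-1 : F) ^ e i * (-1) ^ e i = 1 := fun i => by rw [← mul_pow]; simp
  have h11 : P 1 1 = P 0 0 := hflip _ _ _ _ (by simp) (by simp)
  have h10 : P 1 0 = P 0 1 := hflip _ _ _ _ (by simp) (by simp [hsq])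
  rw [htotal]
  simp only [Fin.sum_univ_two]
  rw [h11, h10, h00, Fin.prod_univ_castSucc]
  simp only [halfConj, Fin.val_zero, Fin.val_one, pow_zero, pow_one]
  split_ifs
  · field_simp
    ring
  · ring

end GenusBasis

lemma prod_neg_one_pow_of_prod_neg {n u : ℕ} (hu : u ≤ n) (Q : Fin (n + 1) → ℤ)
    (hneg : ∏ i, Q i < 0)
    (hsign : ∀ i : Fin (n + 1), ((i : ℕ) < u → 0 < Q i) ∧ (u ≤ (i : ℕ) → Q i < 0)) :
    ∏ i : Fin n, (-1 : ℤ) ^ (if u ≤ (i : ℕ) then 1 else 0) = 1 := by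
  have hlast : Q (Fin.last n) < 0 := (hsign _).2 (by simpa using hu)
  rw [Fin.prod_univ_castSucc] at hneg
  have hpos : 0 < ∏ i : Fin n, Q i.castSucc := pos_of_mul_neg_left hneg hlast.le
  have habs : ∏ i : Fin n, Q i.castSucc =
      (∏ i : Fin n, (-1 : ℤ) ^ (if u ≤ (i : ℕ) then 1 else 0)) * ∏ i : Fin n, |Q i.castSucc| := by
    rw [← Finset.prod_mul_distrib]
    refine Finset.prod_congr rfl fun i _ => ?_
    have h := hsign i.castSucc
    rw [Fin.val_castSucc] at h
    split_ifs with hi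
    · simp [abs_of_neg (h.2 hi)]
    · simp [abs_of_pos (h.1 (not_le.1 hi))]
  rw [Finset.prod_pow_eq_pow_sum] at habs ⊢
  refine (neg_one_pow_eq_or ℤ _).resolve_right fun h => ?_
  rw [h] at habs
  have : 0 ≤ ∏ i : Fin n, |Q i.castSucc| := Finset.prod_nonneg fun i _ => abs_nonneg _
  linarith

/- Here `t = t' + 1`: the (1-based) indices `1, …, t−1` correspond to `i.castSucc` for
`i : Fin t'`, and the index `t` corresponds to `Fin.last t'`; vectors `μ ∈ {0,1}^{t−1}`
are functions `μ : Fin t' → Fin 2`. -/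
theorem stmt11 (t' : ℕ) (d : ℤ) (hd : IsNegFundamentalDiscriminant d)
    (Q : Fin (t' + 1) → ℤ) (hQ : ∀ i, IsPrimeDiscriminant (Q i))
    (hcop : Pairwise fun i j => IsCoprime (Q i) (Q j)) (hprod : d = ∏ i, Q i)
    (hodd : ∀ i, Odd (Q i))
    (u : ℕ) (hu : u ≤ t')
    (hsign : ∀ i : Fin (t' + 1), ((i : ℕ) < u → 0 < Q i) ∧ (u ≤ (i : ℕ) → Q i < 0))
    (a abar : Fin (t' + 1) → ℂ)
    (ha : ∀ i, a i = (1 + csqrt (Q i : ℝ)) / 2)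
    (habar : ∀ i, abar i = (1 - csqrt (Q i : ℝ)) / 2)
    -- `K_G = ℚ(√q_1*, …, √q_t*)` generated inside `ℂ`
    (K : IntermediateField ℚ ℂ)
    (hK : K = IntermediateField.adjoin ℚ (Set.range fun i => csqrt (Q i : ℝ)))
    (β βstar : (Fin t' → Fin 2) → ℂ)
    (hβ : ∀ s, β s =
      (∏ i : Fin t', if (i : ℕ) < u then
          abar i.castSucc ^ (s i : ℕ) * a i.castSucc ^ (1 - (s i : ℕ)) else 1) *
        ((∏ i : Fin t', if u ≤ (i : ℕ) then
            abar i.castSucc ^ (s i : ℕ) * a i.castSucc ^ (1 - (s i : ℕ)) else 1) *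
            a (Fin.last t') +
         (∏ i : Fin t', if u ≤ (i : ℕ) then
            abar i.castSucc ^ (1 - (s i : ℕ)) * a i.castSucc ^ (s i : ℕ) else 1) *
            abar (Fin.last t')))
    (hβstar : ∀ s, βstar s =
      (∏ i : Fin t', if (i : ℕ) < u then
          (-abar i.castSucc) ^ (s i : ℕ) * a i.castSucc ^ (1 - (s i : ℕ)) else 1) *
        ((∏ i : Fin t', if u ≤ (i : ℕ) then
            (-abar i.castSucc) ^ (s i : ℕ) * a i.castSucc ^ (1 - (s i : ℕ)) else 1) *
            a (Fin.last t') -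
         (∏ i : Fin t', if u ≤ (i : ℕ) then
            abar i.castSucc ^ (1 - (s i : ℕ)) * (-a i.castSucc) ^ (s i : ℕ) else 1) *
            abar (Fin.last t')))
    -- the `ℚ`-algebra automorphisms `τ_μ` of `K_G`
    (τ : (Fin t' → Fin 2) → (K ≃ₐ[ℚ] K))
    (hτ : ∀ (μ : Fin t' → Fin 2) (i : Fin t') (x : K),
      (x : ℂ) = csqrt (Q i.castSucc : ℝ) →
        ((τ μ x : K) : ℂ) = (-1 : ℂ) ^ (μ i : ℕ) * csqrt (Q i.castSucc : ℝ))
    (hτlast : ∀ (μ : Fin t' → Fin 2) (x : K),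
      (x : ℂ) = csqrt (Q (Fin.last t') : ℝ) →
        ((τ μ x : K) : ℂ) = csqrt (Q (Fin.last t') : ℝ)) :
    ∀ η ν : Fin t' → Fin 2, ∀ z : K, (z : ℂ) = β η * βstar ν →
      ∑ μ : Fin t' → Fin 2,
          (-1 : ℂ) ^ (∑ i, (μ i : ℕ)) * ((τ μ z : K) : ℂ) =
        if η = ν then ∏ i, csqrt (Q i : ℝ) else 0 := by
  intro η ν z hz
  set e : Fin t' → ℕ := fun i => if u ≤ (i : ℕ) then 1 else 0 with he_def
  set r : Fin (t' + 1) → ℂ := fun i => csqrt (Q i : ℝ) with hr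
  have ha' : ∀ i, a i = halfConj (r i) 0 := fun i => by simp [ha, halfConj, hr]
  have hb' : ∀ i, abar i = halfConj (r i) 1 := fun i => by
    simp [habar, halfConj, hr, sub_eq_add_neg]
  have hper : ∀ x : ℂ, halfConj x (1 + 1) = halfConj x 0 := fun x => by simp [halfConj]
  have hβ' : ∀ s, β s = genusBeta e r s := by
    intro s
    rw [hβ, genusBeta, Fin.sum_univ_two, mul_add, ← mul_assoc, ← mul_assoc,
      ← Finset.prod_mul_distrib, ← Finset.prod_mul_distrib, ha', hb']
    congr 2 <;> refine Finset.prod_congr rfl fun i _ => ?_ <;>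
      rcases lt_or_ge (i : ℕ) u with h | h <;>
      rcases Fin.exists_fin_two.1 ⟨s i, rfl⟩ with h' | h' <;>
      simp [he_def, h, not_le.2, not_lt.2, h', ha', hb', hper]
  have hβstar' : ∀ s, βstar s = genusBetaStar e r s := by
    intro s
    rw [hβstar, genusBetaStar, Fin.sum_univ_two, mul_sub, ← mul_assoc, ← mul_assoc,
      ← Finset.prod_mul_distrib, ← Finset.prod_mul_distrib, ha', hb', sub_eq_add_neg, ← mul_neg]
    congr 2
    any_goals simp; done
    all_goals
      refine Finset.prod_congr rfl fun i _ => ?_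
      rcases lt_or_ge (i : ℕ) u with h | h <;>
      rcases Fin.exists_fin_two.1 ⟨s i, rfl⟩ with h' | h' <;>
      simp [he_def, h, not_le.2, not_lt.2, h', ha', hb', hper]
  have hmem : ∀ i, r i ∈ K := fun i => by
    rw [hK]
    exact IntermediateField.subset_adjoin _ _ ⟨i, rfl⟩
  set R : Fin (t' + 1) → K := fun i => ⟨r i, hmem i⟩ with hR
  have hzK : z = genusBeta e R η * genusBetaStar e R ν := by
    apply (algebraMap K ℂ).injective
    rw [map_mul, map_genusBeta, map_genusBetaStar]
    exact hz.trans (by rw [hβ', hβstar']; rfl)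
  have hτz : ∀ μ, ((τ μ z : K) : ℂ) = genusBeta e (fun i => (τ μ (R i) : ℂ)) η *
      genusBetaStar e (fun i => (τ μ (R i) : ℂ)) ν := by
    intro μ
    have h := map_mul ((algebraMap K ℂ).comp (τ μ : K →+* K)) (genusBeta e R η)
      (genusBetaStar e R ν)
    rw [← hzK, map_genusBeta, map_genusBetaStar] at h
    exact h
  have he : ∏ i, (-1 : ℂ) ^ e i = 1 := by
    have h := prod_neg_one_pow_of_prod_neg hu Q (hprod ▸ hd.1) hsign
    exact_mod_cast congrArg (Int.cast : ℤ → ℂ) h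
  simp only [hτz]
  exact sum_genusBeta_mul_genusBetaStar e he r (fun μ i => (τ μ (R i) : ℂ))
    (fun μ i => hτ μ i _ rfl) (fun μ => hτlast μ _ rfl) η ν
end
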